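/- Let k be a field, q a nonzero element of k, and m ≤ n positive integers. Then the quantum grassmannian O_q(G_{m,n}(k)) is a quantum graded algebra with a straightening law on the poset (Π_{m,n}, ≤st) of maximal quantum minors. -/

import Mathlib

/-- A *quantum graded algebra with a straightening law* over the field `k`, on the finite
poset `ι` (whose elements are realised in `A` via the map `elem`). -/
structure QuantumGradedASL (k : Type*) [Field k] (A : Type*) [Ring A] [Algebra k A]
    (𝒜 : ℕ → Submodule k A) (ι : Type*) [PartialOrder ι] [Finite ι] where
  /-- the map realising the elements of the poset `Π = ι` as elements of `A` -/
  elem : ι → A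
  /-- `A` is an `ℕ`-graded `k`-algebra with grading `𝒜` -/
  graded : GradedAlgebra 𝒜
  /-- (1) the elements of `Π` are homogeneous of positive degree -/
  homog : ∀ i : ι, ∃ d : ℕ, 0 < d ∧ elem i ∈ 𝒜 d
  /-- (2) the elements of `Π` generate `A` as a `k`-algebra -/
  gen : Algebra.adjoin k (Set.range elem) = ⊤
  /-- (3) the standard monomials (products of the `elem i` along nondecreasing lists,
  the empty product being `1`) form a linearly independent family -/
  indep : LinearIndependent k
    (fun l : {l : List ι // l.Chain' (· ≤ ·)} => ((l : List ι).map elem).prod)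
  /-- (4) if `a`, `b` are incomparable then `elem a * elem b` is a linear combination of
  terms `elem lam` or `elem lam * elem mu` with `lam ≤ mu`, `lam < a` and `lam < b` -/
  straighten : ∀ a b : ι, ¬ a ≤ b → ¬ b ≤ a →
    elem a * elem b ∈ Submodule.span k {x : A | ∃ lam : ι, lam < a ∧ lam < b ∧
      (x = elem lam ∨ ∃ mu : ι, lam ≤ mu ∧ x = elem lam * elem mu)}
  /-- (5) for all `a`, `b` there is `0 ≠ c ∈ k` such that `elem a * elem b - c • (elem b * elem a)`
  is a linear combination of terms `elem lam` or `elem lam * elem mu` with `lam ≤ mu`,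
  `lam < a` and `lam < b` -/
  comm : ∀ a b : ι, ∃ c : k, c ≠ 0 ∧
    elem a * elem b - c • (elem b * elem a) ∈
      Submodule.span k {x : A | ∃ lam : ι, lam < a ∧ lam < b ∧
        (x = elem lam ∨ ∃ mu : ι, lam ≤ mu ∧ x = elem lam * elem mu)}

/-- The defining relations of the algebra of quantum `m × n` matrices, with parameter the
unit `u`, imposed on the free algebra on the generators `X (i,j)`. -/
inductive qMatrixRel (R : Type*) [CommRing R] (u : Rˣ) (m n : ℕ) :
    FreeAlgebra R (Fin m × Fin n) → FreeAlgebra R (Fin m × Fin n) → Prop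
  | row : ∀ (i : Fin m) (j l : Fin n), j < l →
      qMatrixRel R u m n (FreeAlgebra.ι R (i, j) * FreeAlgebra.ι R (i, l))
        ((u : R) • (FreeAlgebra.ι R (i, l) * FreeAlgebra.ι R (i, j)))
  | col : ∀ (i k : Fin m) (j : Fin n), i < k →
      qMatrixRel R u m n (FreeAlgebra.ι R (i, j) * FreeAlgebra.ι R (k, j))
        ((u : R) • (FreeAlgebra.ι R (k, j) * FreeAlgebra.ι R (i, j)))
  | antidiag : ∀ (i k : Fin m) (j l : Fin n), k < i → j < l →
      qMatrixRel R u m n (FreeAlgebra.ι R (i, j) * FreeAlgebra.ι R (k, l))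
        (FreeAlgebra.ι R (k, l) * FreeAlgebra.ι R (i, j))
  | diag : ∀ (i k : Fin m) (j l : Fin n), i < k → j < l →
      qMatrixRel R u m n (FreeAlgebra.ι R (i, j) * FreeAlgebra.ι R (k, l))
        (FreeAlgebra.ι R (k, l) * FreeAlgebra.ι R (i, j) +
          ((u : R) - ((u⁻¹ : Rˣ) : R)) • (FreeAlgebra.ι R (i, l) * FreeAlgebra.ι R (k, j)))

/-- The algebra `O_u(M_{m,n}(R))` of quantum `m × n` matrices over `R`. -/
abbrev QuantumMat (R : Type*) [CommRing R] (u : Rˣ) (m n : ℕ) :=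
  RingQuot (qMatrixRel R u m n)

/-- The generator `X i j` of the algebra of quantum matrices. -/
def qX (R : Type*) [CommRing R] (u : Rˣ) {m n : ℕ} (i : Fin m) (j : Fin n) :
    QuantumMat R u m n :=
  RingQuot.mkAlgHom R (qMatrixRel R u m n) (FreeAlgebra.ι R (i, j))

/-- The number of inversions (i.e. the Coxeter length) of a permutation of `Fin t`. -/
def permLength {t : ℕ} (σ : Equiv.Perm (Fin t)) : ℕ :=
  (Finset.univ.filter fun p : Fin t × Fin t => p.1 < p.2 ∧ σ p.2 < σ p.1).card

/-- The index set `Π_{m,n}` of maximal quantum minors consists of the `m`-element subsets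
`{j₁ < ⋯ < j_m} ⊆ {1,…,n}`, encoded as order embeddings `Fin m ↪o Fin n`; it carries the
standard partial order `I ≤st J ↔ ∀ s, i_s ≤ j_s` (pointwise order). -/
instance piPartialOrder (m n : ℕ) : PartialOrder (Fin m ↪o Fin n) :=
  PartialOrder.lift (fun f => (f : Fin m → Fin n)) DFunLike.coe_injective

instance piFinite (m n : ℕ) : Finite (Fin m ↪o Fin n) :=
  Finite.of_injective (fun f => (f : Fin m → Fin n)) DFunLike.coe_injective

/-- The maximal quantum minor `[J] = Σ_{σ ∈ S_m} (−u)^{ℓ(σ)} X_{1 j_{σ(1)}} ⋯ X_{m j_{σ(m)}}`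
of the generic matrix, for a column index set `J ∈ Π_{m,n}`. -/
def qMaximalMinor (R : Type*) [CommRing R] (u : Rˣ) {m n : ℕ} (J : Fin m ↪o Fin n) :
    QuantumMat R u m n :=
  ∑ σ : Equiv.Perm (Fin m),
    ((-(u : R)) ^ permLength σ) • (List.ofFn fun i : Fin m => qX R u i (J (σ i))).prod

/-- The quantum grassmannian `O_q(G_{m,n}(K))`: the `K`-subalgebra of `O_q(M_{m,n}(K))`
generated by the maximal quantum minors `[J]`, `J ∈ Π_{m,n}`. -/
def QuantumGrassmannian (K : Type*) [CommRing K] (u : Kˣ) (m n : ℕ) :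
    Subalgebra K (QuantumMat K u m n) :=
  Algebra.adjoin K (Set.range fun J : Fin m ↪o Fin n => qMaximalMinor K u J)

/-- The maximal quantum minor `[J]` viewed as an element of the quantum grassmannian. -/
def grMinor (K : Type*) [CommRing K] (u : Kˣ) {m n : ℕ} (J : Fin m ↪o Fin n) :
    QuantumGrassmannian K u m n :=
  ⟨qMaximalMinor K u J, Algebra.subset_adjoin ⟨J, rfl⟩⟩

section QuantumMinors

variable {k A I J : Type*} [Field k] [Ring A] [Algebra k A] [LinearOrder I] [LinearOrder J]

/-- The relations of quantum matrices, imposed on a matrix `X` with entries in an algebra. -/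
structure IsQuantumMatrix (q : k) (X : I → J → A) : Prop where
  row : ∀ i j l, j < l → X i j * X i l = q • (X i l * X i j)
  col : ∀ i i' j, i < i' → X i j * X i' j = q • (X i' j * X i j)
  antidiag : ∀ i i' j l, i' < i → j < l → X i j * X i' l = X i' l * X i j
  diag : ∀ i i' j l, i < i' → j < l →
    X i j * X i' l = X i' l * X i j + (q - q⁻¹) • (X i l * X i' j)

theorem IsQuantumMatrix.transpose {q : k} {X : I → J → A} (hX : IsQuantumMatrix q X) :
    IsQuantumMatrix q (fun j i => X i j) where
  row j i l h := hX.col i l j h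
  col j l i h := hX.row i j l h
  antidiag j l i i' h h' := (hX.antidiag i' i l j h' h).symm
  diag j l i i' h h' := by
    rw [hX.diag i i' j l h' h, hX.antidiag i' i j l h' h]

/-- The number of elements of `K` smaller than `y`. -/
def numBelow (K : Finset J) (y : J) : ℕ := (K.filter (· < y)).card

theorem numBelow_erase_of_lt {K : Finset J} {y z : J} (hy : y ∈ K) (h : y < z) :
    numBelow (K.erase y) z + 1 = numBelow K z := by
  unfold numBelow
  rw [Finset.filter_erase, Finset.card_erase_add_one]
  simp [hy, h]

theorem numBelow_erase_of_le {K : Finset J} {y z : J} (h : z ≤ y) :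
    numBelow (K.erase y) z = numBelow K z := by
  unfold numBelow
  rw [Finset.filter_erase, Finset.erase_eq_of_notMem]
  simp [h]

/-- Left multiplication by the vector `x` in the quantum exterior algebra over `A`, elements of
which are described by their coordinates, indexed by finite sets. -/
def qWedge (p : k) (x : J → A) (φ : Finset J → A) (K : Finset J) : A :=
  ∑ y ∈ K, p ^ numBelow K y • (x y * φ (K.erase y))

theorem sum_sum_erase {M : Type*} [AddCommMonoid M] (K : Finset J) (G : J → J → M) :
    ∑ y ∈ K, ∑ z ∈ K.erase y, G y z =
      ∑ y ∈ K, ∑ z ∈ K.filter (y < ·), (G y z + G z y) := by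
  have h1 : ∀ y ∈ K, ∑ z ∈ K.erase y, G y z =
      ∑ z ∈ K.filter (y < ·), G y z + ∑ z ∈ K.filter (· < y), G y z := by
    intro y hy
    rw [← Finset.sum_union]
    · congr 1
      ext z
      simp only [Finset.mem_erase, Finset.mem_union, Finset.mem_filter]
      constructor
      · rintro ⟨h, hz⟩
        rcases lt_or_gt_of_ne h with h | h <;> simp [h, hz]
      · rintro (⟨hz, h⟩ | ⟨hz, h⟩)
        · exact ⟨h.ne', hz⟩
        · exact ⟨h.ne, hz⟩
    · rw [Finset.disjoint_filter]
      intro z _ h h'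
      exact lt_asymm h h'
  rw [Finset.sum_congr rfl h1, Finset.sum_add_distrib]
  simp_rw [Finset.sum_add_distrib]
  congr 1
  simp_rw [Finset.sum_filter]
  rw [Finset.sum_comm]

theorem qWedge_qWedge (p : k) (x x' : J → A) (φ : Finset J → A) (K : Finset J) :
    qWedge p x (qWedge p x' φ) K = ∑ y ∈ K, ∑ z ∈ K.filter (y < ·),
      p ^ (numBelow K y + numBelow (K.erase y) z) •
        ((x y * x' z + p • (x z * x' y)) * φ ((K.erase y).erase z)) := by
  unfold qWedge
  simp_rw [Finset.mul_sum, Finset.smul_sum]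
  rw [sum_sum_erase]
  refine Finset.sum_congr rfl fun y hy => Finset.sum_congr rfl fun z hz => ?_
  have hlt := (Finset.mem_filter.1 hz).2
  rw [numBelow_erase_of_le (y := z) hlt.le, ← numBelow_erase_of_lt hy hlt,
    Finset.erase_right_comm (a := z)]
  simp only [mul_smul_comm, add_mul, smul_add, smul_smul, smul_mul_assoc, mul_assoc]
  congr 2 <;> ring

theorem qWedge_smul (p c : k) (x : J → A) (φ : Finset J → A) :
    qWedge p x (c • φ) = c • qWedge p x φ := by
  ext K
  simp only [qWedge, Pi.smul_apply, Finset.smul_sum]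
  refine Finset.sum_congr rfl fun y _ => ?_
  rw [mul_smul_comm, smul_comm]

theorem qWedge_zero (p : k) (x : J → A) : qWedge p x 0 = 0 := by
  ext K
  simp [qWedge]

theorem IsQuantumMatrix.qWedge_self {q : k} {X : I → J → A} (hX : IsQuantumMatrix q X)
    (r : I) (φ : Finset J → A) : qWedge (-q) (X r) (qWedge (-q) (X r) φ) = 0 := by
  ext K
  rw [qWedge_qWedge]
  refine Finset.sum_eq_zero fun y _ => Finset.sum_eq_zero fun z hz => ?_
  rw [hX.row r y z (Finset.mem_filter.1 hz).2]
  simp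

theorem IsQuantumMatrix.qWedge_swap {q : k} (hq : q ≠ 0) {X : I → J → A}
    (hX : IsQuantumMatrix q X) {r s : I} (h : r < s) (φ : Finset J → A) :
    qWedge (-q) (X s) (qWedge (-q) (X r) φ) =
      (-q) • qWedge (-q) (X r) (qWedge (-q) (X s) φ) := by
  ext K
  rw [Pi.smul_apply, qWedge_qWedge, qWedge_qWedge, Finset.smul_sum]
  refine Finset.sum_congr rfl fun y _ => ?_
  rw [Finset.smul_sum]
  refine Finset.sum_congr rfl fun z hz => ?_
  have hlt := (Finset.mem_filter.1 hz).2
  have key : X s y * X r z + (-q) • (X s z * X r y) =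
      (-q) • (X r y * X s z + (-q) • (X r z * X s y)) := by
    rw [hX.diag r s y z h hlt, hX.antidiag s r y z h hlt]
    match_scalars <;> field_simp
    ring
  rw [key, smul_mul_assoc, smul_comm]

/-- The coordinates of the product of the rows listed in `rs` of the matrix `X` in the quantum
exterior algebra: the quantum minors with these rows. -/
def rowMinor {R : Type*} (p : k) (X : R → J → A) (rs : List R) : Finset J → A :=
  rs.foldr (fun r φ => qWedge p (X r) φ) (Pi.single ∅ 1)

theorem rowMinor_nil {R : Type*} (p : k) (X : R → J → A) (K : Finset J) :
    rowMinor p X [] K = if K = ∅ then 1 else 0 := by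
  simp [rowMinor, Pi.single_apply]

theorem rowMinor_cons {R : Type*} (p : k) (X : R → J → A) (r : R) (rs : List R) :
    rowMinor p X (r :: rs) = qWedge p (X r) (rowMinor p X rs) := rfl

theorem rowMinor_of_length_ne {R : Type*} (p : k) (X : R → J → A) (rs : List R) :
    ∀ K : Finset J, rs.length ≠ K.card → rowMinor p X rs K = 0 := by
  induction rs with
  | nil =>
    intro K h
    rw [rowMinor_nil, if_neg]
    rintro rfl
    simp at h
  | cons r rs ih =>
    intro K h
    rw [rowMinor_cons]
    refine Finset.sum_eq_zero fun y hy => ?_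
    rw [ih, mul_zero, smul_zero]
    rw [Finset.card_erase_of_mem hy]
    have := Finset.card_pos.2 ⟨y, hy⟩
    simp at h
    omega

theorem IsQuantumMatrix.exists_rowMinor_perm {q : k} (hq : q ≠ 0) {X : I → J → A}
    (hX : IsQuantumMatrix q X) {l l' : List I} (h : l.Perm l') :
    ∃ c : k, c ≠ 0 ∧ rowMinor (-q) X l = c • rowMinor (-q) X l' := by
  induction h with
  | nil => exact ⟨1, one_ne_zero, by simp⟩
  | cons x _ ih =>
    obtain ⟨c, hc, h⟩ := ih
    exact ⟨c, hc, by rw [rowMinor_cons, rowMinor_cons, h, qWedge_smul]⟩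
  | swap x y l =>
    simp only [rowMinor_cons]
    rcases lt_trichotomy x y with h | rfl | h
    · exact ⟨-q, neg_ne_zero.2 hq, hX.qWedge_swap hq h _⟩
    · exact ⟨1, one_ne_zero, by simp⟩
    · refine ⟨(-q)⁻¹, inv_ne_zero (neg_ne_zero.2 hq), ?_⟩
      rw [hX.qWedge_swap hq h, smul_smul, inv_mul_cancel₀ (neg_ne_zero.2 hq), one_smul]
  | trans _ _ ih ih' =>
    obtain ⟨c, hc, h⟩ := ih
    obtain ⟨c', hc', h'⟩ := ih'
    exact ⟨c * c', mul_ne_zero hc hc', by rw [h, h', smul_smul]⟩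

theorem IsQuantumMatrix.rowMinor_of_not_nodup {q : k} (hq : q ≠ 0) {X : I → J → A}
    (hX : IsQuantumMatrix q X) {l : List I} (h : ¬ l.Nodup) : rowMinor (-q) X l = 0 := by
  induction l with
  | nil => simp at h
  | cons r l ih =>
    rw [List.nodup_cons, not_and_or, not_not] at h
    rcases h with h | h
    · obtain ⟨c, -, h'⟩ := hX.exists_rowMinor_perm hq ((List.perm_cons_erase h).cons r)
      rw [h', rowMinor_cons, rowMinor_cons, hX.qWedge_self, smul_zero]
    · rw [rowMinor_cons, ih h, qWedge_zero]

/-- The number of pairs in `S × T` in the wrong order. -/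
def numInv (S T : Finset J) : ℕ := ∑ x ∈ S, numBelow T x

theorem numBelow_union {S T : Finset J} (h : Disjoint S T) (y : J) :
    numBelow (S ∪ T) y = numBelow S y + numBelow T y := by
  unfold numBelow
  rw [Finset.filter_union, Finset.card_union_of_disjoint (Finset.disjoint_filter_filter h)]

theorem rowMinor_append {R : Type*} (p : k) (X : R → J → A) (rs rs' : List R) : ∀ K : Finset J,
    rowMinor p X (rs ++ rs') K = ∑ S ∈ K.powerset,
      p ^ numInv S (K \ S) • (rowMinor p X rs S * rowMinor p X rs' (K \ S)) := by
  induction rs with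
  | nil =>
    intro K
    rw [Finset.sum_eq_single ∅]
    · simp [rowMinor_nil, numInv]
    · intro S _ hS
      simp [rowMinor_nil, hS]
    · simp
  | cons r rs ih =>
    intro K
    rw [List.cons_append, rowMinor_cons, rowMinor_cons]
    unfold qWedge
    simp_rw [Finset.sum_mul, ih, Finset.mul_sum, Finset.smul_sum]
    rw [Finset.sum_sigma', Finset.sum_sigma']
    refine Finset.sum_bij' (fun a _ => ⟨insert a.1 a.2, a.1⟩) (fun b _ => ⟨b.2, b.1.erase b.2⟩)
      ?_ ?_ ?_ ?_ ?_
    · rintro ⟨y, S⟩ h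
      simp only [Finset.mem_sigma, Finset.mem_powerset, Finset.mem_insert, true_or, and_true] at h ⊢
      exact Finset.insert_subset h.1 (h.2.trans (Finset.erase_subset _ _))
    · rintro ⟨S, y⟩ h
      simp only [Finset.mem_sigma, Finset.mem_powerset] at h ⊢
      exact ⟨h.1 h.2, Finset.erase_subset_erase _ h.1⟩
    · rintro ⟨y, S⟩ h
      simp only [Finset.mem_sigma, Finset.mem_powerset] at h ⊢
      rw [Finset.erase_insert fun h' => Finset.notMem_erase y K (h.2 h')]
    · rintro ⟨S, y⟩ h
      simp only [Finset.mem_sigma, Finset.mem_powerset] at h ⊢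
      rw [Finset.insert_erase h.2]
    · rintro ⟨y, S⟩ h
      simp only [Finset.mem_sigma, Finset.mem_powerset] at h ⊢
      have hy : y ∉ S := fun h' => Finset.notMem_erase y K (h.2 h')
      have hK : K.erase y \ S = K \ insert y S := by
        ext z; simp; tauto
      rw [Finset.erase_insert hy, hK]
      simp only [mul_smul_comm, smul_mul_assoc, smul_smul, mul_assoc, ← pow_add]
      congr 2
      have h1 : numBelow K y = numBelow (insert y S) y + numBelow (K \ insert y S) y := by
        rw [← numBelow_union Finset.disjoint_sdiff, Finset.union_sdiff_of_subset]
        exact Finset.insert_subset h.1 (h.2.trans (Finset.erase_subset _ _))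
      rw [h1, numInv, numInv, Finset.sum_insert hy]
      ring

theorem rowMinor_sort_of_min (p : k) (X : I → J → A) {P : Finset I} {r : I} (hr : r ∈ P)
    (hmin : ∀ s ∈ P, r ≤ s) (K : Finset J) :
    rowMinor p X P.sort K =
      ∑ y ∈ K, p ^ numBelow K y • (X r y * rowMinor p X (P.erase r).sort (K.erase y)) := by
  have : P.sort = r :: (P.erase r).sort := by
    conv_lhs => rw [← Finset.insert_erase hr]
    exact Finset.sort_insert _ (fun b hb => hmin b (Finset.mem_of_mem_erase hb))
      (Finset.notMem_erase r P)
  rw [this, rowMinor_cons, qWedge]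

theorem numBelow_of_min {K : Finset J} {y : J} (hmin : ∀ s ∈ K, y ≤ s) : numBelow K y = 0 := by
  simpa [numBelow, Finset.filter_eq_empty_iff] using hmin

/-- Expanding a quantum minor by rows or by columns gives the same result. -/
theorem IsQuantumMatrix.rowMinor_sort {q : k} {X : I → J → A} (hX : IsQuantumMatrix q X)
    (P : Finset I) (K : Finset J) :
    rowMinor (-q) X P.sort K = rowMinor (-q) (fun j i => X i j) K.sort P := by
  induction hN : P.card using Nat.strong_induction_on generalizing P K with
  | _ N ih =>
    subst hN
    rcases P.eq_empty_or_nonempty with rfl | hP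
    · by_cases hK : K = ∅
      · simp [hK, rowMinor_nil]
      · rw [rowMinor_of_length_ne, rowMinor_of_length_ne] <;>
          simp [Ne.symm, hK, eq_comm]
    rcases K.eq_empty_or_nonempty with rfl | hK
    · rw [rowMinor_of_length_ne, rowMinor_of_length_ne] <;>
          simp [hP.ne_empty, eq_comm]
    obtain ⟨r, hr, hrmin⟩ : ∃ r ∈ P, ∀ s ∈ P, r ≤ s :=
      ⟨P.min' hP, P.min'_mem hP, fun s hs => P.min'_le s hs⟩
    obtain ⟨c, hc, hcmin⟩ : ∃ r ∈ K, ∀ s ∈ K, r ≤ s :=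
      ⟨K.min' hK, K.min'_mem hK, fun s hs => K.min'_le s hs⟩
    have hPr := Finset.card_erase_lt_of_mem hr
    rw [rowMinor_sort_of_min _ _ hr hrmin, rowMinor_sort_of_min _ _ hc hcmin,
      ← Finset.add_sum_erase _ _ hc, ← Finset.add_sum_erase _ _ hr, numBelow_of_min hcmin,
      numBelow_of_min hrmin, ih _ hPr _ _ rfl]
    congr 1
    have h1 : ∀ y ∈ K.erase c, rowMinor (-q) X (P.erase r).sort (K.erase y) =
        ∑ s ∈ P.erase r, (-q) ^ numBelow (P.erase r) s • (X s c *
          rowMinor (-q) X ((P.erase r).erase s).sort ((K.erase c).erase y)) := by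
      intro y hy
      rw [ih _ hPr _ _ rfl, rowMinor_sort_of_min _ _ (Finset.mem_erase.2
        ⟨(Finset.ne_of_mem_erase hy).symm, hc⟩) fun s hs => hcmin s (Finset.mem_of_mem_erase hs)]
      refine Finset.sum_congr rfl fun s hs => ?_
      rw [Finset.erase_right_comm, ih _ ((Finset.card_erase_lt_of_mem hs).trans hPr) _ _ rfl]
    have h2 : ∀ s ∈ P.erase r, rowMinor (-q) (fun j i => X i j) (K.erase c).sort (P.erase s) =
        ∑ y ∈ K.erase c, (-q) ^ numBelow (K.erase c) y • (X r y *
          rowMinor (-q) X ((P.erase r).erase s).sort ((K.erase c).erase y)) := by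
      intro s hs
      rw [← ih _ (Finset.card_erase_lt_of_mem (Finset.mem_of_mem_erase hs)) _ _ rfl,
        rowMinor_sort_of_min _ _ (Finset.mem_erase.2 ⟨(Finset.ne_of_mem_erase hs).symm, hr⟩)
          fun s hs => hrmin s (Finset.mem_of_mem_erase hs), Finset.erase_right_comm]
    refine (Finset.sum_congr rfl fun y hy => congrArg
      (fun w => (-q) ^ numBelow K y • (X r y * w)) (h1 y hy)).trans (Eq.trans ?_
      (Finset.sum_congr rfl fun s hs => congrArg
        (fun w => (-q) ^ numBelow P s • (X s c * w)) (h2 s hs)).symm)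
    simp_rw [Finset.mul_sum, Finset.smul_sum]
    rw [Finset.sum_comm]
    refine Finset.sum_congr rfl fun s hs => Finset.sum_congr rfl fun y hy => ?_
    have hrs : r < s := lt_of_le_of_ne (hrmin s (Finset.mem_of_mem_erase hs))
      (Finset.ne_of_mem_erase hs).symm
    have hcy : c < y := lt_of_le_of_ne (hcmin y (Finset.mem_of_mem_erase hy))
      (Finset.ne_of_mem_erase hy).symm
    rw [← numBelow_erase_of_lt hr hrs, ← numBelow_erase_of_lt hc hcy]
    simp only [mul_smul_comm, smul_smul, ← mul_assoc, hX.antidiag s r c y hrs hcy]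
    congr 1
    ring

/-- The generalised quantum Plücker relations. -/
theorem IsQuantumMatrix.plucker [Fintype I] {q : k} (hq : q ≠ 0) {X : I → J → A}
    (hX : IsQuantumMatrix q X) (l₁ l₂ : List J) {K : Finset J} (hK : Fintype.card I < K.card) :
    ∑ S ∈ K.powerset, (-q) ^ numInv S (K \ S) •
      (rowMinor (-q) (fun j i => X i j) (l₁ ++ S.sort) Finset.univ *
        rowMinor (-q) (fun j i => X i j) ((K \ S).sort ++ l₂) Finset.univ) = 0 := by
  have key : ∀ P Q : Finset I, ∑ S ∈ K.powerset, (-q) ^ numInv S (K \ S) •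
      (rowMinor (-q) (fun j i => X i j) S.sort P *
        rowMinor (-q) (fun j i => X i j) (K \ S).sort Q) = 0 := by
    intro P Q
    simp_rw [← hX.rowMinor_sort]
    rw [← rowMinor_append]
    by_cases h : (P.sort ++ Q.sort).length = K.card
    · rw [hX.rowMinor_of_not_nodup hq, Pi.zero_apply]
      intro hn
      have := hn.length_le_card
      omega
    · exact rowMinor_of_length_ne _ _ _ _ h
  simp_rw [rowMinor_append, Finset.sum_mul_sum, Finset.smul_sum]
  rw [Finset.sum_comm]
  refine Finset.sum_eq_zero fun P _ => ?_
  rw [Finset.sum_comm]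
  refine Finset.sum_eq_zero fun Q _ => ?_
  have := key (Finset.univ \ P) Q
  calc _ = ((-q) ^ numInv P (Finset.univ \ P) * (-q) ^ numInv Q (Finset.univ \ Q)) •
        (rowMinor (-q) (fun j i => X i j) l₁ P *
        (∑ S ∈ K.powerset, (-q) ^ numInv S (K \ S) •
          (rowMinor (-q) (fun j i => X i j) S.sort (Finset.univ \ P) *
          rowMinor (-q) (fun j i => X i j) (K \ S).sort Q)) *
        rowMinor (-q) (fun j i => X i j) l₂ (Finset.univ \ Q)) := by
        rw [Finset.mul_sum, Finset.sum_mul, Finset.smul_sum]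
        refine Finset.sum_congr rfl fun S _ => ?_
        simp only [mul_smul_comm, smul_mul_assoc, smul_smul, mul_assoc]
        congr 1
        ring
    _ = 0 := by rw [this]; simp

end QuantumMinors

section PermutationExpansion

/-- The permutation of `Fin (t + 1)` sending `0` to `a` and inducing `τ` on the other elements,
identified with `Fin t` by their order. -/
def consPerm {t : ℕ} (a : Fin (t + 1)) (τ : Equiv.Perm (Fin t)) : Equiv.Perm (Fin (t + 1)) :=
  (finSuccEquiv' 0).trans ((Equiv.optionCongr τ).trans (finSuccEquiv' a).symm)

theorem consPerm_zero {t : ℕ} (a : Fin (t + 1)) (τ : Equiv.Perm (Fin t)) :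
    consPerm a τ 0 = a := by
  simp [consPerm]

theorem consPerm_succ {t : ℕ} (a : Fin (t + 1)) (τ : Equiv.Perm (Fin t)) (i : Fin t) :
    consPerm a τ i.succ = a.succAbove (τ i) := by
  have : finSuccEquiv' (0 : Fin (t + 1)) i.succ = some i := by
    rw [← Fin.succAbove_zero_apply, finSuccEquiv'_succAbove]
  simp [consPerm, this]

theorem consPerm_bijective (t : ℕ) : Function.Bijective
    (fun x : Fin (t + 1) × Equiv.Perm (Fin t) => consPerm x.1 x.2) := by
  rw [Fintype.bijective_iff_injective_and_card]
  constructor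
  · rintro ⟨a, τ⟩ ⟨b, τ'⟩ h
    have h0 := DFunLike.congr_fun h 0
    simp only [consPerm_zero] at h0
    subst h0
    refine Prod.ext rfl (Equiv.ext fun i => ?_)
    have h1 := DFunLike.congr_fun h i.succ
    simpa only [consPerm_succ, Fin.succAbove_right_inj] using h1
  · simp [Fintype.card_perm, Nat.factorial_succ]

theorem permLength_eq_sum {t : ℕ} (σ : Equiv.Perm (Fin t)) :
    permLength σ = ∑ i, ∑ j, if i < j ∧ σ j < σ i then 1 else 0 := by
  rw [permLength, Finset.card_filter, Fintype.sum_prod_type]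

theorem permLength_consPerm {t : ℕ} (a : Fin (t + 1)) (τ : Equiv.Perm (Fin t)) :
    permLength (consPerm a τ) = a + permLength τ := by
  rw [permLength_eq_sum, permLength_eq_sum, Fin.sum_univ_succ]
  congr 1
  · rw [Fin.sum_univ_succ]
    simp only [lt_irrefl, false_and, if_false, Fin.succ_pos, true_and, consPerm_zero,
      consPerm_succ, zero_add]
    rw [Equiv.sum_comp τ (fun x => if a.succAbove x < a then 1 else 0), ← Finset.card_filter]
    simp only [Fin.succAbove_lt_iff_castSucc_lt]
    have : (Finset.univ.filter fun x : Fin t => x.castSucc < a) =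
        Finset.univ.filter fun x : Fin t => (x : ℕ) < a := by
      ext x; simp [Fin.lt_def]
    rw [this, Fin.card_filter_val_lt, min_eq_right]
    omega
  · refine Finset.sum_congr rfl fun i _ => ?_
    rw [Fin.sum_univ_succ]
    simp [consPerm_succ, Fin.succAbove_lt_succAbove_iff]

variable {k A I J : Type*} [Field k] [Ring A] [Algebra k A] [LinearOrder I] [LinearOrder J]

theorem rowMinor_ofFn {R : Type*} (p : k) (X : R → J → A) :
    ∀ {t : ℕ} (r : Fin t → R) (f : Fin t ↪o J),
    rowMinor p X (List.ofFn r) (Finset.univ.map f.toEmbedding) =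
      ∑ σ : Equiv.Perm (Fin t),
        p ^ permLength σ • (List.ofFn fun i => X (r i) (f (σ i))).prod
  | 0, r, f => by
    simp [rowMinor_nil, permLength, Finset.univ_eq_empty]
  | t + 1, r, f => by
    rw [List.ofFn_succ, rowMinor_cons, qWedge, Finset.sum_map,
      ← (consPerm_bijective t).sum_comp
        (fun σ => p ^ permLength σ • (List.ofFn fun i => X (r i) (f (σ i))).prod),
      Fintype.sum_prod_type]
    refine Finset.sum_congr rfl fun a _ => ?_
    have h1 : numBelow (Finset.univ.map f.toEmbedding) (f.toEmbedding a) = a := by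
      rw [numBelow, Finset.filter_map, Finset.card_map]
      have : (Finset.univ.filter ((· < f.toEmbedding a) ∘ f.toEmbedding)) = Finset.Iio a := by
        ext b
        simp
      rw [this, Fin.card_Iio]
    have h2 : (Finset.univ.map f.toEmbedding).erase (f.toEmbedding a) =
        Finset.univ.map ((Fin.succAboveOrderEmb a).trans f).toEmbedding := by
      ext x
      simp only [Finset.mem_erase, Finset.mem_map, Finset.mem_univ, true_and,
        RelEmbedding.coe_toEmbedding, RelEmbedding.coe_trans, Function.comp_apply,
        Fin.succAboveOrderEmb_apply]
      constructor
      · rintro ⟨hx, b, rfl⟩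
        obtain ⟨c, rfl⟩ := Fin.exists_succAbove_eq (x := b) (y := a) fun h => hx (by rw [h])
        exact ⟨c, rfl⟩
      · rintro ⟨c, rfl⟩
        exact ⟨fun h => Fin.succAbove_ne a c (f.injective h), _, rfl⟩
    rw [h1, h2, rowMinor_ofFn, Finset.mul_sum, Finset.smul_sum]
    refine Finset.sum_congr rfl fun τ _ => ?_
    rw [permLength_consPerm, List.ofFn_succ, List.prod_cons]
    simp only [consPerm_zero, consPerm_succ, mul_smul_comm, smul_smul, pow_add]
    rfl

end PermutationExpansion

section MaximalMinors

variable {k A : Type*} [Field k] [Ring A] [Algebra k A] {m n : ℕ}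

/-- The maximal quantum minor of the matrix `X` with column set `J`. -/
def maxMinor (p : k) (X : Fin m → Fin n → A) (J : Fin m ↪o Fin n) : A :=
  ∑ σ : Equiv.Perm (Fin m), p ^ permLength σ • (List.ofFn fun i => X i (J (σ i))).prod

theorem List.Pairwise.sort_toFinset {J : Type*} [LinearOrder J] {l : List J}
    (h : l.Pairwise (· < ·)) : l.toFinset.sort (· ≤ ·) = l :=
  (List.toFinset_sort _ (h.imp fun h => h.ne)).2 (h.imp fun h => h.le)

theorem OrderEmbedding.pairwise_ofFn (J : Fin m ↪o Fin n) : (List.ofFn J).Pairwise (· < ·) :=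
  List.pairwise_ofFn.2 fun _ _ h => J.strictMono h

theorem IsQuantumMatrix.maxMinor_eq {q : k} {X : Fin m → Fin n → A}
    (hX : IsQuantumMatrix q X) (J : Fin m ↪o Fin n) :
    maxMinor (-q) X J = rowMinor (-q) (fun j i => X i j) (List.ofFn J) Finset.univ := by
  have h1 := rowMinor_ofFn (-q) X id J
  have h2 : (Finset.univ.map J.toEmbedding) = (List.ofFn J).toFinset := by
    ext x
    simp
  rw [List.ofFn_id, ← Fin.sort_univ, hX.rowMinor_sort, h2,
    (OrderEmbedding.pairwise_ofFn J).sort_toFinset] at h1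
  exact h1.symm

theorem IsQuantumMatrix.rowMinor_univ_eq_zero_or {q : k} (hq : q ≠ 0) {X : Fin m → Fin n → A}
    (hX : IsQuantumMatrix q X) (l : List (Fin n)) :
    rowMinor (-q) (fun j i => X i j) l Finset.univ = 0 ∨
      ∃ (c : k) (L : Fin m ↪o Fin n), (l : Multiset (Fin n)) = (List.ofFn L : List (Fin n)) ∧
        rowMinor (-q) (fun j i => X i j) l Finset.univ = c • maxMinor (-q) X L := by
  by_cases hl : l.length = m
  swap
  · exact Or.inl (rowMinor_of_length_ne _ _ _ _ (by simpa using hl))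
  by_cases hnd : l.Nodup
  swap
  · left
    rw [hX.transpose.rowMinor_of_not_nodup hq hnd, Pi.zero_apply]
  right
  have hcard : l.toFinset.card = m := by rw [List.toFinset_card_of_nodup hnd, hl]
  have hperm : l.Perm (List.ofFn (l.toFinset.orderEmbOfFin hcard)) := by
    rw [List.perm_ext_iff_of_nodup hnd
      ((OrderEmbedding.pairwise_ofFn _).imp fun h => h.ne)]
    intro a
    rw [List.mem_ofFn', Finset.range_orderEmbOfFin]
    simp
  obtain ⟨c, -, hc⟩ := hX.transpose.exists_rowMinor_perm hq hperm
  refine ⟨c, _, Multiset.coe_eq_coe.2 hperm, ?_⟩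
  rw [hc, Pi.smul_apply, hX.maxMinor_eq]

/-- Exchanging elements of a set against smaller ones decreases the sum. -/
theorem sum_lt_sum_of_exchange {S T : Finset (Fin n)} (hcard : S.card = T.card) (hne : S ≠ T)
    (hlt : ∀ x ∈ S \ T, ∀ y ∈ T, x < y) :
    ∑ x ∈ S, (x : ℕ) < ∑ x ∈ T, (x : ℕ) := by
  rw [← Finset.sum_sdiff_lt_sum_sdiff]
  have hc := Finset.card_sdiff_comm hcard
  have hT : (T \ S).Nonempty := by
    rw [Finset.sdiff_nonempty]
    exact fun h => hne (Finset.eq_of_subset_of_card_le h hcard.le).symm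
  have hS : (S \ T).Nonempty := by
    rwa [← Finset.card_pos, hc, Finset.card_pos]
  set y := (T \ S).min' hT with hy
  have hyT := Finset.min'_mem _ hT
  calc ∑ x ∈ S \ T, (x : ℕ) < ∑ x ∈ S \ T, (y : ℕ) :=
        Finset.sum_lt_sum_of_nonempty hS fun x hx =>
          hlt x hx y (Finset.sdiff_subset hyT)
    _ = (T \ S).card • (y : ℕ) := by rw [Finset.sum_const, hc]
    _ ≤ ∑ x ∈ T \ S, (x : ℕ) :=
        Finset.card_nsmul_le_sum _ _ _ fun x hx => Finset.min'_le _ _ hx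

theorem IsQuantumMatrix.maxMinor_mul_mem_span {q : k} (hq : q ≠ 0) {X : Fin m → Fin n → A}
    (hX : IsQuantumMatrix q X) (I J : Fin m ↪o Fin n) :
    maxMinor (-q) X I * maxMinor (-q) X J ∈ Submodule.span k
      {x | ∃ L M : Fin m ↪o Fin n, L ≤ M ∧
        ((List.ofFn L : List (Fin n)) : Multiset (Fin n)) + (List.ofFn M : List (Fin n)) =
          (List.ofFn I : List (Fin n)) + (List.ofFn J : List (Fin n)) ∧
        x = maxMinor (-q) X L * maxMinor (-q) X M} := by
  induction hN : (((List.ofFn I : List (Fin n)) : Multiset (Fin n)).map Fin.val).sum using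
    Nat.strong_induction_on generalizing I J with
  | _ N ih =>
  by_cases hIJ : I ≤ J
  · exact Submodule.subset_span ⟨I, J, hIJ, rfl, rfl⟩
  obtain ⟨s, hs⟩ : ∃ s, J s < I s := by
    by_contra! h
    exact hIJ h
  set lI := List.ofFn I with hlI
  set lJ := List.ofFn J with hlJ
  have hIp := OrderEmbedding.pairwise_ofFn I
  have hJp := OrderEmbedding.pairwise_ofFn J
  set tI := lI.drop s with htI
  set tJ := lJ.take (s + 1) with htJ
  have htIp : tI.Pairwise (· < ·) := hIp.sublist (List.drop_sublist _ _)
  have htJp : tJ.Pairwise (· < ·) := hJp.sublist (List.take_sublist _ _)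
  have hlt : ∀ x ∈ tJ.toFinset, ∀ y ∈ tI.toFinset, x < y := by
    intro x hx y hy
    rw [List.mem_toFinset, htJ, List.mem_take_iff_getElem] at hx
    rw [List.mem_toFinset, htI, List.mem_drop_iff_getElem] at hy
    obtain ⟨a, ha, rfl⟩ := hx
    obtain ⟨b, hb, rfl⟩ := hy
    simp only [hlI, hlJ, List.getElem_ofFn]
    simp only [hlI, hlJ, List.length_ofFn] at ha hb
    refine lt_of_le_of_lt (J.monotone ?_) (lt_of_lt_of_le hs (I.monotone ?_))
    · rw [Fin.le_def]; simp; omega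
    · rw [Fin.le_def]; simp
  have hdisj : Disjoint tJ.toFinset tI.toFinset := by
    rw [Finset.disjoint_left]
    exact fun x hx hy => lt_irrefl _ (hlt x hx x hy)
  have hcI : tI.toFinset.card = m - s := by
    rw [List.toFinset_card_of_nodup (htIp.imp fun h => h.ne), htI, List.length_drop, hlI,
      List.length_ofFn]
  have hcJ : tJ.toFinset.card = s + 1 := by
    rw [List.toFinset_card_of_nodup (htJp.imp fun h => h.ne), htJ, List.length_take, hlJ,
      List.length_ofFn]
    omega
  have hK : Fintype.card (Fin m) < (tJ.toFinset ∪ tI.toFinset).card := by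
    rw [Finset.card_union_of_disjoint hdisj, hcI, hcJ, Fintype.card_fin]
    omega
  have hpl := hX.plucker hq (lI.take s) (lJ.drop (s + 1)) hK
  set K := tJ.toFinset ∪ tI.toFinset with hKdef
  have hmem : tI.toFinset ∈ K.powerset :=
    Finset.mem_powerset.2 Finset.subset_union_right
  rw [← Finset.add_sum_erase _ _ hmem] at hpl
  have hKS : K \ tI.toFinset = tJ.toFinset := by
    rw [hKdef, Finset.union_sdiff_right, Finset.sdiff_eq_self_of_disjoint hdisj]
  rw [hKS, htIp.sort_toFinset, htJp.sort_toFinset, htI, htJ, List.take_append_drop,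
    List.take_append_drop, ← hX.maxMinor_eq, ← hX.maxMinor_eq, add_eq_zero_iff_eq_neg] at hpl
  rw [← Submodule.smul_mem_iff _ (pow_ne_zero _ (neg_ne_zero.2 hq)), hpl]
  refine Submodule.neg_mem _ (Submodule.sum_mem _ fun S hS => Submodule.smul_mem _ _ ?_)
  rw [Finset.mem_erase, Finset.mem_powerset] at hS
  obtain ⟨hSne, hSK⟩ := hS
  rcases hX.rowMinor_univ_eq_zero_or hq (lI.take s ++ S.sort (· ≤ ·)) with h0 | ⟨c, L, hL, hcL⟩
  · rw [h0, zero_mul]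
    exact Submodule.zero_mem _
  rcases hX.rowMinor_univ_eq_zero_or hq ((K \ S).sort (· ≤ ·) ++ lJ.drop (s + 1)) with
    h0 | ⟨d, M, hM, hdM⟩
  · rw [h0, mul_zero]
    exact Submodule.zero_mem _
  rw [hcL, hdM, smul_mul_smul_comm]
  refine Submodule.smul_mem _ _ ?_
  have hcontent : ((List.ofFn L : List (Fin n)) : Multiset (Fin n)) + (List.ofFn M : List (Fin n))
      = (lI : Multiset (Fin n)) + (lJ : List (Fin n)) := by
    have e1 : (lI : Multiset (Fin n)) = ((lI.take s : List (Fin n)) : Multiset (Fin n)) +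
        tI.toFinset.val := by
      rw [← Finset.sort_eq _ (· ≤ ·), htIp.sort_toFinset, htI, Multiset.coe_add,
        List.take_append_drop]
    have e2 : (lJ : Multiset (Fin n)) = tJ.toFinset.val +
        ((lJ.drop (s + 1) : List (Fin n)) : Multiset (Fin n)) := by
      rw [← Finset.sort_eq _ (· ≤ ·), htJp.sort_toFinset, htJ, Multiset.coe_add,
        List.take_append_drop]
    have e3 : tJ.toFinset.val + tI.toFinset.val = S.val + (K \ S).val := by
      have h1 := congrArg Finset.val (Finset.disjUnion_eq_union _ _ hdisj)
      have h2 := congrArg Finset.val (Finset.disjUnion_eq_union S (K \ S) Finset.disjoint_sdiff)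
      rw [Finset.union_sdiff_of_subset hSK] at h2
      exact h1.trans h2.symm
    rw [← hL, ← hM, ← Multiset.coe_add, ← Multiset.coe_add, Finset.sort_eq, Finset.sort_eq,
      e1, e2, add_assoc, add_assoc, ← add_assoc S.val, ← e3]
    abel
  have hScard : S.card = tI.toFinset.card := by
    have := congrArg Multiset.card hL
    simp only [Multiset.coe_card, List.length_append, List.length_take, Finset.length_sort,
      List.length_ofFn, hlI] at this
    omega
  have hsum : (((List.ofFn L : List (Fin n)) : Multiset (Fin n)).map Fin.val).sum < N := by
    have h1 := sum_lt_sum_of_exchange hScard hSne fun x hx y hy => hlt x (by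
      rw [Finset.mem_sdiff] at hx
      exact (Finset.mem_union.1 (hSK hx.1)).resolve_right hx.2) y hy
    rw [← hN, ← hL]
    conv_rhs => rw [hlI, ← List.take_append_drop s (List.ofFn I), ← hlI, ← htI,
      ← htIp.sort_toFinset]
    rw [← Multiset.coe_add, ← Multiset.coe_add, Finset.sort_eq, Finset.sort_eq,
      Multiset.map_add, Multiset.map_add, Multiset.sum_add, Multiset.sum_add]
    exact Nat.add_lt_add_left h1 _
  have := ih _ hsum L M rfl
  rwa [hcontent] at this

end MaximalMinors

section ProductOfQuantumMatrices

variable {k A I J L : Type*} [Field k] [Ring A] [Algebra k A]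
  [LinearOrder I] [LinearOrder J] [LinearOrder L]

/-- The diagonal coefficients of the R-matrix of type `A`. -/
def rDiag (q : k) (a b : I) : k := if a = b then q else 1

/-- The off-diagonal coefficients of the R-matrix of type `A`. -/
def rOff (q : k) (a b : I) : k := if a < b then q - q⁻¹ else 0

theorem rDiag_comm (q : k) (a b : I) : rDiag q a b = rDiag q b a := by
  simp only [rDiag, eq_comm]

/-- The relations of quantum matrices in the form `R T₁ T₂ = T₂ T₁ R`. -/
theorem IsQuantumMatrix.rtt {q : k} (hq : q ≠ 0) {X : I → J → A} (hX : IsQuantumMatrix q X)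
    (i i' : I) (j l : J) :
    rDiag q i i' • (X i' j * X i l) + rOff q i i' • (X i j * X i' l) =
      rDiag q j l • (X i l * X i' j) + rOff q j l • (X i j * X i' l) := by
  rcases lt_trichotomy i i' with h | rfl | h <;> rcases lt_trichotomy j l with h' | rfl | h'
  · simp [rDiag, rOff, h, h', h.ne, h'.ne, hX.antidiag i' i j l h h']
  · simp only [rDiag, rOff, h, h.ne, if_true, if_false, lt_irrefl, hX.col i i' j h]
    match_scalars
    field_simp
    ring
  · simp [rDiag, rOff, h, h.ne, h'.ne', h'.not_gt, hX.diag i i' l j h h']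
  · simp only [rDiag, rOff, h', h'.ne, if_true, if_false, lt_irrefl, hX.row i j l h']
    match_scalars
    field_simp
    ring
  · simp [rDiag, rOff]
  · simp [rDiag, rOff, h'.ne', h'.not_gt, hX.row i l j h']
  · simp [rDiag, rOff, h', h.ne', h'.ne, h.not_gt, hX.diag i' i j l h h',
      hX.antidiag i i' j l h h']
  · simp [rDiag, rOff, h.ne', h.not_gt, hX.col i' i j h]
  · simp [rDiag, rOff, h.ne', h'.ne', h.not_gt, h'.not_gt, hX.antidiag i i' l j h h']

theorem isQuantumMatrix_of_rtt {q : k} {X : I → J → A}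
    (hX : ∀ (i i' : I) (j l : J),
      rDiag q i i' • (X i' j * X i l) + rOff q i i' • (X i j * X i' l) =
        rDiag q j l • (X i l * X i' j) + rOff q j l • (X i j * X i' l)) :
    IsQuantumMatrix q X where
  row i j l h := by
    have := hX i i l j
    simpa [rDiag, rOff, h.ne', h.not_gt] using this.symm
  col i i' j h := by
    have := hX i' i j j
    simpa [rDiag, rOff, h.ne', h.not_gt] using this
  antidiag i i' j l h h' := by
    have := hX i' i j l
    simpa [rDiag, rOff, h, h', h.ne, h'.ne] using this
  diag i i' j l h h' := by
    have := hX i i' l j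
    simpa [rDiag, rOff, h, h', h.ne, h'.ne', h'.not_gt] using this.symm

theorem IsQuantumMatrix.mul [Fintype J] {q : k} (hq : q ≠ 0) {X : I → J → A} {F : J → L → A}
    (hX : IsQuantumMatrix q X) (hF : IsQuantumMatrix q F)
    (hc : ∀ i j a b, Commute (X i j) (F a b)) :
    IsQuantumMatrix q (fun i b => ∑ a, X i a * F a b) := by
  have hprod : ∀ (i i' : I) (j l : L), (∑ a, X i a * F a j) * (∑ b, X i' b * F b l) =
      ∑ a, ∑ b, (X i a * X i' b) * (F a j * F b l) := by
    intro i i' j l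
    rw [Finset.sum_mul_sum]
    refine Finset.sum_congr rfl fun a _ => Finset.sum_congr rfl fun b _ => ?_
    rw [mul_assoc, mul_assoc, ← mul_assoc (F a j), ← (hc i' b a j).eq, mul_assoc]
  refine isQuantumMatrix_of_rtt fun i i' j l => ?_
  have hl : rDiag q i i' • ((∑ a, X i' a * F a j) * (∑ b, X i b * F b l)) +
      rOff q i i' • ((∑ a, X i a * F a j) * (∑ b, X i' b * F b l)) =
      ∑ a, ∑ b, rDiag q a b • ((X i b * X i' a) * (F a j * F b l)) +
        ∑ a, ∑ b, rOff q a b • ((X i a * X i' b) * (F a j * F b l)) := by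
    rw [hprod, hprod]
    simp only [Finset.smul_sum, ← Finset.sum_add_distrib]
    refine Finset.sum_congr rfl fun a _ => Finset.sum_congr rfl fun b _ => ?_
    simp only [← smul_mul_assoc _ (X _ _ * X _ _), ← add_mul, hX.rtt hq i i' a b]
  have hr : rDiag q j l • ((∑ a, X i a * F a l) * (∑ b, X i' b * F b j)) +
      rOff q j l • ((∑ a, X i a * F a j) * (∑ b, X i' b * F b l)) =
      ∑ a, ∑ b, rDiag q a b • ((X i a * X i' b) * (F b j * F a l)) +
        ∑ a, ∑ b, rOff q a b • ((X i a * X i' b) * (F a j * F b l)) := by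
    rw [hprod, hprod]
    simp only [Finset.smul_sum, ← Finset.sum_add_distrib]
    refine Finset.sum_congr rfl fun a _ => Finset.sum_congr rfl fun b _ => ?_
    simp only [← mul_smul_comm _ (X _ _ * X _ _), ← mul_add, hF.rtt hq a b j l]
  rw [hl, hr]
  congr 1
  rw [Finset.sum_comm]
  simp only [rDiag_comm q]

/-- The matrix differing from the identity matrix in the columns `c` and `c + 1` only, where
the nonzero entries are `x` and `z` on the diagonal and `y` below it. -/
def elementaryMatrix {n : ℕ} (c : Fin n) (x y z : A) (a b : Fin (n + 1)) : A :=
  if b = c.castSucc then (if a = c.castSucc then x else if a = c.succ then y else 0)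
  else if a = b then (if b = c.succ then z else 1) else 0

theorem isQuantumMatrix_elementaryMatrix {n : ℕ} {q : k} (c : Fin n) {x y z : A}
    (hxy : x * y = q • (y * x)) (hyz : y * z = q • (z * y)) (hxz : x * z = z * x) :
    IsQuantumMatrix q (elementaryMatrix c x y z) := by
  have hcs : c.succ ≠ c.castSucc := Fin.castSucc_lt_succ.ne'
  set E := elementaryMatrix c x y z with hE
  have hEd : ∀ a, E a a = if a = c.castSucc then x else if a = c.succ then z else 1 := by
    intro a
    simp only [hE, elementaryMatrix]
    grind
  have hEl : E c.succ c.castSucc = y := by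
    simp [hE, elementaryMatrix, hcs]
  have hlow : ∀ a b : Fin (n + 1), E a b ≠ 0 → a = b ∨ a = c.succ ∧ b = c.castSucc := by
    intro a b h
    simp only [hE, elementaryMatrix] at h
    grind
  have hle : ∀ a b : Fin (n + 1), E a b ≠ 0 → (b : ℕ) ≤ a ∧ (a : ℕ) ≤ b + 1 := by
    intro a b h
    rcases hlow a b h with rfl | ⟨rfl, rfl⟩ <;> simp
  clear_value E
  constructor
  · intro i j l h
    by_cases h1 : E i j = 0
    · simp [h1]
    by_cases h2 : E i l = 0
    · simp [h2]
    rcases hlow _ _ h1 with rfl | ⟨rfl, rfl⟩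
    · have := hle _ _ h2
      omega
    rcases hlow _ _ h2 with rfl | ⟨-, rfl⟩
    · simpa [hEl, hEd, hcs] using hyz
    · exact absurd h (lt_irrefl _)
  · intro i i' j h
    by_cases h1 : E i j = 0
    · simp [h1]
    by_cases h2 : E i' j = 0
    · simp [h2]
    rcases hlow _ _ h2 with rfl | ⟨rfl, rfl⟩
    · have := hle _ _ h1
      omega
    rcases hlow _ _ h1 with rfl | ⟨rfl, -⟩
    · simpa [hEl, hEd, hcs] using hxy
    · exact absurd h (lt_irrefl _)
  · intro i i' j l h h'
    by_cases h1 : E i j = 0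
    · simp [h1]
    by_cases h2 : E i' l = 0
    · simp [h2]
    have := hle _ _ h1
    have := hle _ _ h2
    omega
  · intro i i' j l h h'
    have h0 : E i l * E i' j = 0 := by
      by_contra h0
      have := hle _ _ (left_ne_zero_of_mul h0)
      have := hle _ _ (right_ne_zero_of_mul h0)
      omega
    rw [h0, smul_zero, add_zero]
    by_cases h1 : E i j = 0
    · simp [h1]
    by_cases h2 : E i' l = 0
    · simp [h2]
    rcases hlow _ _ h1 with rfl | ⟨rfl, rfl⟩ <;> rcases hlow _ _ h2 with rfl | ⟨rfl, rfl⟩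
    · rw [hEd, hEd]
      split_ifs <;> simp [hxz]
    · rw [hEd, if_neg h'.ne, if_neg h.ne, one_mul, mul_one]
    · rw [hEd i', if_neg h'.ne', if_neg h.ne', one_mul, mul_one]
    · exact absurd h (lt_irrefl _)

theorem sum_mul_elementaryMatrix {n : ℕ} (c : Fin n) (x y z : A) (X : Fin (n + 1) → A)
    (b : Fin (n + 1)) :
    ∑ a, X a * elementaryMatrix c x y z a b =
      if b = c.castSucc then X c.castSucc * x + X c.succ * y
      else if b = c.succ then X c.succ * z else X b := by
  have hcs : c.succ ≠ c.castSucc := Fin.castSucc_lt_succ.ne'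
  unfold elementaryMatrix
  split_ifs with h1 h2
  · rw [Fintype.sum_eq_add c.castSucc c.succ hcs.symm]
    · simp [hcs]
    · rintro a ⟨h, h'⟩
      simp [h, h']
  · simp [h2]
  · simp

end ProductOfQuantumMatrices

section LeadingTerms

variable {k V : Type*} [Field k] [AddCommMonoid V]

/-- The operator `T` on the free module on `V` raises the order `ord` by at least `N`. -/
def RaisesBy (ord : V →+ ℕ) (T : Module.End k (V →₀ k)) (N : ℕ) : Prop :=
  ∀ v, T (Finsupp.single v 1) ∈ Finsupp.supported k k {w | ord v + N ≤ ord w}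

/-- The operator `T` shifts the basis of the free module on `V` by `e`, up to nonzero scalars
and terms of higher order. -/
def HasLead (ord : V →+ ℕ) (T : Module.End k (V →₀ k)) (e : V) : Prop :=
  ∀ v, ∃ u : k, u ≠ 0 ∧ T (Finsupp.single v 1) - Finsupp.single (v + e) u ∈
    Finsupp.supported k k {w | ord v + ord e + 1 ≤ ord w}

variable {ord : V →+ ℕ}

theorem RaisesBy.map_mem {T : Module.End k (V →₀ k)} {N M : ℕ} (hT : RaisesBy ord T N)
    {x : V →₀ k} (hx : x ∈ Finsupp.supported k k {w | M ≤ ord w}) :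
    T x ∈ Finsupp.supported k k {w | M + N ≤ ord w} := by
  rw [← Finsupp.sum_single x, Finsupp.sum, map_sum]
  refine Submodule.sum_mem _ fun v hv => ?_
  have hMv : M ≤ ord v := hx hv
  rw [← mul_one (x v), ← smul_eq_mul, ← Finsupp.smul_single, map_smul]
  refine Submodule.smul_mem _ _ (Finsupp.supported_mono ?_ (hT v))
  intro w (hw : ord v + N ≤ ord w)
  exact (Nat.add_le_add_right hMv N).trans hw

theorem RaisesBy.mono {T : Module.End k (V →₀ k)} {N M : ℕ} (hT : RaisesBy ord T N)
    (h : M ≤ N) : RaisesBy ord T M := fun v =>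
  Finsupp.supported_mono (fun _ hw => (Nat.add_le_add_left h _).trans hw) (hT v)

theorem RaisesBy.zero (N : ℕ) : RaisesBy ord (0 : Module.End k (V →₀ k)) N := fun v => by
  simp

theorem RaisesBy.smul {T : Module.End k (V →₀ k)} {N : ℕ} (hT : RaisesBy ord T N) (c : k) :
    RaisesBy ord (c • T) N := fun v => Submodule.smul_mem _ c (hT v)

theorem RaisesBy.sum {ι : Type*} {s : Finset ι} {T : ι → Module.End k (V →₀ k)} {N : ℕ}
    (hT : ∀ i ∈ s, RaisesBy ord (T i) N) : RaisesBy ord (∑ i ∈ s, T i) N := fun v => by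
  rw [LinearMap.sum_apply]
  exact Submodule.sum_mem _ fun i hi => hT i hi v

theorem HasLead.raisesBy {T : Module.End k (V →₀ k)} {e : V} (hT : HasLead ord T e) :
    RaisesBy ord T (ord e) := fun v => by
  obtain ⟨u, -, hu⟩ := hT v
  rw [← sub_add_cancel (T (Finsupp.single v 1)) (Finsupp.single (v + e) u)]
  refine Submodule.add_mem _ (Finsupp.supported_mono ?_ hu) (Finsupp.single_mem_supported k _ ?_)
  · exact fun w hw => (Nat.le_succ _).trans hw
  · exact (map_add ord v e).ge

theorem HasLead.add_higher {T T' : Module.End k (V →₀ k)} {e : V} (hT : HasLead ord T e)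
    (hT' : RaisesBy ord T' (ord e + 1)) : HasLead ord (T + T') e := fun v => by
  obtain ⟨u, hu0, hu⟩ := hT v
  refine ⟨u, hu0, ?_⟩
  rw [LinearMap.add_apply, add_sub_right_comm]
  exact Submodule.add_mem _ hu (hT' v)

theorem HasLead.one : HasLead ord (1 : Module.End k (V →₀ k)) 0 := fun v =>
  ⟨1, one_ne_zero, by simp⟩

theorem HasLead.mul {T T' : Module.End k (V →₀ k)} {e e' : V} (hT : HasLead ord T e)
    (hT' : HasLead ord T' e') : HasLead ord (T * T') (e' + e) := fun v => by
  obtain ⟨u', hu0', hu'⟩ := hT' v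
  obtain ⟨u, hu0, hu⟩ := hT (v + e')
  refine ⟨u' * u, mul_ne_zero hu0' hu0, ?_⟩
  have hsplit : (T * T') (Finsupp.single v 1) - Finsupp.single (v + (e' + e)) (u' * u) =
      T (T' (Finsupp.single v 1) - Finsupp.single (v + e') u') +
        u' • (T (Finsupp.single (v + e') 1) - Finsupp.single (v + e' + e) u) := by
    rw [Module.End.mul_apply, map_sub, smul_sub, ← map_smul, Finsupp.smul_single,
      Finsupp.smul_single, smul_eq_mul, smul_eq_mul, mul_one, add_assoc]
    abel
  rw [hsplit]
  refine Submodule.add_mem _ ?_ (Submodule.smul_mem _ _ ?_)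
  · have := hT.raisesBy.map_mem hu'
    refine Finsupp.supported_mono ?_ this
    intro w hw
    simp only [Set.mem_ofPred_eq, map_add] at hw ⊢
    omega
  · refine Finsupp.supported_mono ?_ hu
    intro w hw
    simp only [Set.mem_ofPred_eq, map_add] at hw ⊢
    omega

theorem HasLead.list_prod {ι : Type*} (T : ι → Module.End k (V →₀ k)) (e : ι → V) :
    ∀ l : List ι, (∀ i ∈ l, HasLead ord (T i) (e i)) →
      HasLead ord (l.map T).prod (l.map e).sum
  | [], _ => HasLead.one
  | i :: l, h => by
    rw [List.map_cons, List.map_cons, List.prod_cons, List.sum_cons, add_comm]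
    exact (h i (by simp)).mul (HasLead.list_prod T e l fun j hj => h j (by simp [hj]))

/-- Vectors with distinct leading terms are linearly independent. -/
theorem linearIndependent_of_lead {ι : Type*} (b : ι → V →₀ k) (e : ι → V)
    (he : Function.Injective e)
    (hb : ∀ i, ∃ u : k, u ≠ 0 ∧
      b i - Finsupp.single (e i) u ∈ Finsupp.supported k k {w | ord (e i) + 1 ≤ ord w}) :
    LinearIndependent k b := by
  classical
  rw [linearIndependent_iff']
  intro s g hg
  by_contra! hne
  have hne' : (s.filter fun i => g i ≠ 0).Nonempty := by
    obtain ⟨i, hi, hgi⟩ := hne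
    exact ⟨i, Finset.mem_filter.2 ⟨hi, hgi⟩⟩
  obtain ⟨i, hi, hmin⟩ := Finset.exists_min_image _ (fun i => ord (e i)) hne'
  rw [Finset.mem_filter] at hi
  have hcoord := DFunLike.congr_fun hg (e i)
  rw [Finsupp.coe_zero, Pi.zero_apply, Finsupp.finsetSum_apply,
    Finset.sum_eq_single_of_mem i hi.1] at hcoord
  · obtain ⟨u, hu0, hu⟩ := hb i
    have h0 : (b i - Finsupp.single (e i) u) (e i) = 0 := by
      by_contra h
      have : ord (e i) + 1 ≤ ord (e i) := hu (Finsupp.mem_support_iff.2 h)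
      omega
    rw [Finsupp.sub_apply, Finsupp.single_eq_same, sub_eq_zero] at h0
    rw [Finsupp.smul_apply, h0, smul_eq_mul] at hcoord
    exact mul_ne_zero hi.2 hu0 hcoord
  · intro j hj hji
    by_cases hgj : g j = 0
    · simp [hgj]
    have hle := hmin j (Finset.mem_filter.2 ⟨hj, hgj⟩)
    obtain ⟨u, hu0, hu⟩ := hb j
    have h0 : (b j - Finsupp.single (e j) u) (e i) = 0 := by
      by_contra h
      have : ord (e j) + 1 ≤ ord (e i) := hu (Finsupp.mem_support_iff.2 h)
      omega
    rw [Finsupp.sub_apply, Finsupp.single_eq_of_ne (fun h => hji (he h).symm), sub_zero] at h0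
    simp [h0]

/-- The operator on the free module on `V` shifting the basis by `e`, with weights `f`. -/
noncomputable def weightedShift (f : V → k) (e : V) : Module.End k (V →₀ k) :=
  Finsupp.linearCombination k fun v => Finsupp.single (v + e) (f v)

theorem weightedShift_single (f : V → k) (e v : V) (a : k) :
    weightedShift f e (Finsupp.single v a) = Finsupp.single (v + e) (a * f v) := by
  simp [weightedShift]

theorem weightedShift_mul (f g : V → k) (e e' : V) :
    weightedShift f e * weightedShift g e' =
      weightedShift (fun v => g v * f (v + e')) (e' + e) := by
  refine Finsupp.lhom_ext fun v a => ?_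
  rw [Module.End.mul_apply, weightedShift_single, weightedShift_single, weightedShift_single,
    add_assoc, mul_assoc]

theorem smul_weightedShift (f : V → k) (e : V) (c : k) :
    c • weightedShift f e = weightedShift (fun v => c * f v) e := by
  refine Finsupp.lhom_ext fun v a => ?_
  rw [LinearMap.smul_apply, weightedShift_single, weightedShift_single, Finsupp.smul_single,
    smul_eq_mul, mul_left_comm]

theorem hasLead_weightedShift {f : V → k} (hf : ∀ v, f v ≠ 0) (e : V) :
    HasLead ord (weightedShift f e) e := fun v =>
  ⟨f v, hf v, by simp [weightedShift_single]⟩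

end LeadingTerms

section PathModel

variable {k : Type*} [Field k] {m n : ℕ}

/-- The exponents of the monomials in a set of variables indexed by `Fin m × Fin n`. -/
abbrev CellExp (m n : ℕ) : Type := Fin m × Fin n → ℕ

/-- The weighted degree in which the variables in row `i` have weight `i`. -/
def rowOrd (m n : ℕ) : CellExp m n →+ ℕ where
  toFun v := ∑ c, (c.1 : ℕ) * v c
  map_zero' := by simp
  map_add' v w := by simp [mul_add, Finset.sum_add_distrib]

theorem rowOrd_single (c : Fin m × Fin n) : rowOrd m n (Pi.single c 1) = c.1 := by
  simp [rowOrd, Pi.single_apply]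

/-- The indicator function of the cells of row `i` weakly to the right of column `j`. -/
def tailExp (n : ℕ) (i : Fin m) (j : ℕ) : CellExp m n :=
  fun c => if c.1 = i ∧ j ≤ c.2 then 1 else 0

theorem rowOrd_tailExp (i : Fin m) (j : ℕ) : rowOrd m n (tailExp n i j) = i * (n - j) := by
  have h : ∀ b : Fin m, ∑ c : Fin n, (b : ℕ) * tailExp n i j (b, c) =
      if b = i then (i : ℕ) * (n - j) else 0 := by
    intro b
    by_cases hb : b = i
    · subst hb
      simp only [tailExp, true_and, if_true, ← Finset.mul_sum]
      rw [← Finset.card_filter]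
      have h1 := Finset.card_filter_add_card_filter_not (s := (Finset.univ : Finset (Fin n)))
        (fun c : Fin n => (c : ℕ) < j)
      simp only [not_lt, Fin.card_filter_val_lt, Finset.card_univ, Fintype.card_fin] at h1
      congr 1
      omega
    · simp [tailExp, hb]
  change ∑ c : Fin m × Fin n, (c.1 : ℕ) * tailExp n i j c = _
  rw [Fintype.sum_prod_type, Finset.sum_congr rfl fun b _ => h b]
  simp

theorem tailExp_castSucc (i : Fin m) (c : Fin n) :
    tailExp n i c = tailExp n i (c + 1) + Pi.single (i, c) 1 := by
  funext x
  obtain ⟨a, b⟩ := x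
  simp only [tailExp, Pi.add_apply, Pi.single_apply, Prod.mk.injEq, Fin.ext_iff]
  split_ifs <;> omega

theorem tailExp_last (i : Fin m) : tailExp n i n = 0 := by
  funext x
  have := x.2.isLt
  simp [tailExp]

/-- Multiplication by the variable of the cell `c`. -/
noncomputable def cellShift (k : Type*) [Field k] (c : Fin m × Fin n) :
    Module.End k (CellExp m n →₀ k) :=
  weightedShift (fun _ => 1) (Pi.single c 1)

/-- Rescaling of the variable of the cell `c` by the factor `q`. -/
noncomputable def cellScale (q : k) (c : Fin m × Fin n) : Module.End k (CellExp m n →₀ k) :=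
  weightedShift (fun v => q ^ v c) 0

/-- The operators attached to a cell which occur in the model. -/
def cellOps (q : k) (c : Fin m × Fin n) : Set (Module.End k (CellExp m n →₀ k)) :=
  {cellScale q c, cellShift k c, cellScale q⁻¹ c}

theorem cellScale_comm (q q' : k) (c c' : Fin m × Fin n) :
    cellScale q c * cellScale q' c' = cellScale q' c' * cellScale q c := by
  simp only [cellScale, weightedShift_mul, add_zero, mul_comm]

theorem cellScale_mul_cellShift (q : k) (c : Fin m × Fin n) :
    cellScale q c * cellShift k c = q • (cellShift k c * cellScale q c) := by
  simp only [cellScale, cellShift, weightedShift_mul, smul_weightedShift, add_zero, zero_add,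
    mul_one, Pi.add_apply, Pi.single_eq_same, pow_succ, mul_comm]

theorem cellShift_mul_cellScale_inv {q : k} (hq : q ≠ 0) (c : Fin m × Fin n) :
    cellShift k c * cellScale q⁻¹ c = q • (cellScale q⁻¹ c * cellShift k c) := by
  rw [cellScale_mul_cellShift, smul_smul, mul_inv_cancel₀ hq, one_smul]

theorem commute_of_mem_cellOps {q : k} {c c' : Fin m × Fin n} (h : c ≠ c')
    {T T' : Module.End k (CellExp m n →₀ k)} (hT : T ∈ cellOps q c) (hT' : T' ∈ cellOps q c') :
    Commute T T' := by
  have hs : ∀ {p : k} {c c' : Fin m × Fin n}, c ≠ c' →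
      Commute (cellScale p c) (cellShift k c') := by
    intro p c c' h
    simp only [Commute, SemiconjBy, cellScale, cellShift, weightedShift_mul, add_zero, zero_add,
      one_mul, mul_one, Pi.add_apply, Pi.single_eq_of_ne h]
  have hss : Commute (cellShift k c) (cellShift k c') := by
    simp only [Commute, SemiconjBy, cellShift, weightedShift_mul, add_comm]
  have hkk : ∀ p p' : k, Commute (cellScale p c) (cellScale p' c') := fun p p' =>
    cellScale_comm p p' c c'
  rcases hT with hT | hT | hT <;> rcases hT' with hT' | hT' | hT' <;> rw [hT, hT']
  · exact hkk _ _
  · exact hs h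
  · exact hkk _ _
  · exact (hs h.symm).symm
  · exact hss
  · exact (hs h.symm).symm
  · exact hkk _ _
  · exact hs h
  · exact hkk _ _

/-- The matrix `X`, whose entries are operators, is a quantum matrix with leading terms given
by `tailExp`, supported in the positions satisfying `P`, which commutes with the operators
attached to the cells in `U`. -/
structure IsPathModel (q : k) (P : Fin m → Fin (n + 1) → Prop) (U : Set (Fin m × Fin n))
    (X : Fin m → Fin (n + 1) → Module.End k (CellExp m n →₀ k)) : Prop where
  quantum : IsQuantumMatrix q X
  zero : ∀ i j, ¬ P i j → X i j = 0
  lead : ∀ i j, P i j → HasLead (rowOrd m n) (X i j) (tailExp n i j)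
  comm : ∀ c ∈ U, ∀ T ∈ cellOps q c, ∀ i j, Commute (X i j) T

theorem IsPathModel.empty (q : k) (U : Set (Fin m × Fin n)) :
    IsPathModel q (fun _ _ => False) U
      (0 : Fin m → Fin (n + 1) → Module.End k (CellExp m n →₀ k)) where
  quantum := ⟨by simp, by simp, by simp, by simp⟩
  zero _ _ _ := rfl
  lead _ _ h := h.elim
  comm _ _ _ _ _ _ := Commute.zero_left _

/-- Starting a new row: the last column is replaced by a standard basis vector. -/
theorem IsPathModel.newRow {q : k} {P : Fin m → Fin (n + 1) → Prop} {U : Set (Fin m × Fin n)}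
    {X : Fin m → Fin (n + 1) → Module.End k (CellExp m n →₀ k)} (hX : IsPathModel q P U X)
    (p : Fin m) (hP : ∀ i j, P i j → i < p) :
    IsPathModel q (fun i j => P i j ∧ j ≠ Fin.last n ∨ i = p ∧ j = Fin.last n) U
      (fun i j => if j = Fin.last n then (if i = p then 1 else 0) else X i j) where
  quantum := by
    have hlast : ∀ {j l : Fin (n + 1)}, j < l → j ≠ Fin.last n := fun h => (h.trans_le
      (Fin.le_last _)).ne
    have h0 : ∀ i j, p ≤ i → X i j = 0 := fun i j h => hX.zero i j fun hP' =>
      (hP i j hP').not_ge h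
    constructor
    · intro i j l h
      simp only [hlast h, if_false]
      by_cases hl : l = Fin.last n
      · by_cases hi : i = p
        · simp [hl, hi, h0 p j le_rfl]
        · simp [hl, hi]
      · simp only [hl, if_false]
        exact hX.quantum.row i j l h
    · intro i i' j h
      by_cases hj : j = Fin.last n
      · by_cases hi : i = p
        · simp [hj, hi, (hi ▸ h).ne']
        · simp [hj, hi]
      · simp only [hj, if_false]
        exact hX.quantum.col i i' j h
    · intro i i' j l h h'
      simp only [hlast h', if_false]
      by_cases hl : l = Fin.last n
      · by_cases hi : i' = p
        · simp [hl, hi]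
        · simp [hl, hi]
      · simp only [hl, if_false]
        exact hX.quantum.antidiag i i' j l h h'
    · intro i i' j l h h'
      simp only [hlast h', if_false]
      by_cases hl : l = Fin.last n
      · by_cases hi : i = p
        · subst hi
          simp [hl, h.ne', h0 _ _ h.le]
        · by_cases hi' : i' = p
          · simp [hl, hi, hi']
          · simp [hl, hi, hi']
      · simp only [hl, if_false]
        exact hX.quantum.diag i i' j l h h'
  zero i j h := by
    by_cases hj : j = Fin.last n
    · have : i ≠ p := fun hi => h (Or.inr ⟨hi, hj⟩)
      simp [hj, this]
    · simp only [hj, if_false]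
      exact hX.zero i j fun h' => h (Or.inl ⟨h', hj⟩)
  lead i j h := by
    rcases h with ⟨h, hj⟩ | ⟨rfl, rfl⟩
    · simp only [hj, if_false]
      exact hX.lead i j h
    · simp only [if_true, Fin.val_last, tailExp_last]
      exact HasLead.one
  comm c hc T hT i j := by
    split_ifs
    · exact Commute.one_left _
    · exact Commute.zero_left _
    · exact hX.comm c hc T hT i j

/-- Adding the cell `(p, c)` to a model. -/
theorem IsPathModel.addCell {q : k} (hq : q ≠ 0) {P : Fin m → Fin (n + 1) → Prop}
    {U : Set (Fin m × Fin n)} {X : Fin m → Fin (n + 1) → Module.End k (CellExp m n →₀ k)}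
    (hX : IsPathModel q P U X) (p : Fin m) (c : Fin n) (hU : (p, c) ∈ U)
    (hle : ∀ i j, P i j → i ≤ p) (hprev : P p c.succ) (hnew : ¬ P p c.castSucc)
    (habove : ∀ i < p, P i c.castSucc) :
    IsPathModel q (fun i j => P i j ∨ i = p ∧ j = c.castSucc) (U \ {(p, c)})
      (fun i b => if b = c.castSucc then
          X i c.castSucc * cellScale q (p, c) + X i c.succ * cellShift k (p, c)
        else if b = c.succ then X i c.succ * cellScale q⁻¹ (p, c) else X i b) := by
  have hcs : c.succ ≠ c.castSucc := Fin.castSucc_lt_succ.ne'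
  have hops : ∀ {i j T}, T ∈ cellOps q (p, c) → Commute (X i j) T := fun hT =>
    hX.comm _ hU _ hT _ _
  have mx : cellScale q (p, c) ∈ cellOps q (p, c) := by simp [cellOps]
  have my : cellShift k (p, c) ∈ cellOps q (p, c) := by simp [cellOps]
  have mz : cellScale q⁻¹ (p, c) ∈ cellOps q (p, c) := by simp [cellOps]
  have scale_lead : ∀ {T e} {a : k}, a ≠ 0 → HasLead (rowOrd m n) T e →
      HasLead (rowOrd m n) (T * cellScale a (p, c)) e := by
    intro T e a ha hT
    have := hT.mul (hasLead_weightedShift (ord := rowOrd m n)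
      (fun v => pow_ne_zero (v (p, c)) ha) 0)
    rwa [zero_add] at this
  have shift_lead : ∀ {T e}, HasLead (rowOrd m n) T e →
      HasLead (rowOrd m n) (T * cellShift k (p, c)) (e + Pi.single (p, c) 1) := by
    intro T e hT
    have := hT.mul (hasLead_weightedShift (k := k) (ord := rowOrd m n)
      (fun _ => one_ne_zero) (Pi.single (p, c) 1))
    rwa [add_comm] at this
  refine ⟨?_, ?_, ?_, ?_⟩
  · have := hX.quantum.mul hq (isQuantumMatrix_elementaryMatrix c
      (cellScale_mul_cellShift q (p, c)) (cellShift_mul_cellScale_inv hq (p, c))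
      (cellScale_comm q q⁻¹ (p, c) (p, c))) (by
        intro i j a b
        unfold elementaryMatrix
        split_ifs
        · exact hops mx
        · exact hops my
        · exact Commute.zero_right _
        · exact hops mz
        · exact Commute.one_right _
        · exact Commute.zero_right _)
    simpa only [sum_mul_elementaryMatrix] using this
  · intro i j h
    rw [not_or] at h
    split_ifs with h1 h2
    · subst h1
      have hi : ¬ i ≤ p := fun hi => (lt_or_eq_of_le hi).elim (fun hi => h.1 (habove i hi))
        fun hi => h.2 ⟨hi, rfl⟩
      rw [hX.zero i _ h.1, hX.zero i _ fun h' => hi (hle _ _ h')]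
      simp
    · subst h2
      rw [hX.zero i _ h.1, zero_mul]
    · exact hX.zero i _ h.1
  · intro i j h
    by_cases h1 : j = c.castSucc
    · subst h1
      simp only [if_true]
      by_cases hi : i = p
      · subst hi
        rw [hX.zero i _ hnew, zero_mul, zero_add, Fin.val_castSucc, tailExp_castSucc]
        exact shift_lead (hX.lead _ _ hprev)
      · have hlt : i < p := lt_of_le_of_ne (h.elim (hle _ _) fun h => h.1.le) hi
        refine (scale_lead hq (hX.lead _ _ (habove i hlt))).add_higher ?_
        by_cases hP : P i c.succ
        · refine (shift_lead (hX.lead _ _ hP)).raisesBy.mono ?_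
          rw [Fin.val_castSucc, tailExp_castSucc, map_add, map_add, rowOrd_single, rowOrd_single]
          exact Nat.add_lt_add_left hlt _
        · rw [hX.zero _ _ hP, zero_mul]
          exact RaisesBy.zero _
    · have hP : P i j := h.resolve_right fun h => h1 h.2
      rw [if_neg h1]
      split_ifs with h2
      · subst h2
        exact scale_lead (inv_ne_zero hq) (hX.lead _ _ hP)
      · exact hX.lead _ _ hP
  · rintro c' ⟨hc', hne⟩ T hT i j
    have hne' : (p, c) ≠ c' := fun h => hne h.symm
    have hXT : ∀ b, Commute (X i b) T := fun b => hX.comm _ hc' _ hT _ _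
    have ops : ∀ {S}, S ∈ cellOps q (p, c) → Commute S T := fun hS =>
      commute_of_mem_cellOps hne' hS hT
    split_ifs
    · exact ((hXT _).mul_left (ops mx)).add_left ((hXT _).mul_left (ops my))
    · exact (hXT _).mul_left (ops mz)
    · exact hXT _

end PathModel

section PathModelExistence

variable {k : Type*} [Field k] {m n : ℕ}

theorem IsPathModel.mono {q : k} {P : Fin m → Fin (n + 1) → Prop}
    {U U' : Set (Fin m × Fin n)} {X : Fin m → Fin (n + 1) → Module.End k (CellExp m n →₀ k)}
    (hX : IsPathModel q P U X) (h : U' ⊆ U) : IsPathModel q P U' X :=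
  ⟨hX.quantum, hX.zero, hX.lead, fun c hc => hX.comm c (h hc)⟩

theorem IsPathModel.exists_addCells {q : k} (hq : q ≠ 0) {γ : Fin m → ℕ} (hγ : Monotone γ)
    (p : Fin m) {P : Fin m → Fin (n + 1) → Prop}
    {X : Fin m → Fin (n + 1) → Module.End k (CellExp m n →₀ k)}
    (hX : IsPathModel q P {c | p ≤ c.1} X)
    (hP : ∀ i j, P i j → i < p)
    (hPγ : ∀ i < p, ∀ j, j ≠ Fin.last n → (P i j ↔ γ i ≤ j)) (d : ℕ) (hd : d + γ p ≤ n) :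
    ∃ P' X', IsPathModel q P' {c | p < c.1 ∨ p = c.1 ∧ c.2 + d < n} X' ∧
      (∀ i j, P' i j → i ≤ p) ∧
      (∀ i < p, ∀ j, j ≠ Fin.last n → (P' i j ↔ γ i ≤ j)) ∧
      ∀ j : Fin (n + 1), P' p j ↔ n ≤ j + d := by
  induction d with
  | zero =>
    refine ⟨_, _, (hX.newRow p hP).mono ?_, ?_, ?_, ?_⟩
    · rintro c (h | h)
      · exact h.le
      · exact h.1.le
    · rintro i j (h | h)
      · exact (hP i j h.1).le
      · exact h.1.le
    · intro i hi j hj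
      simp [hi.ne, hj, hPγ i hi j hj]
    · intro j
      have : ¬ P p j := fun h => lt_irrefl _ (hP p j h)
      simp only [this, false_and, true_and, false_or, Fin.ext_iff, Fin.val_last]
      omega
  | succ d ih =>
    obtain ⟨P', X', hX', hle, hPγ', hPp⟩ := ih (by omega)
    obtain ⟨c, hc⟩ : ∃ c : Fin n, (c : ℕ) + d + 1 = n := ⟨⟨n - d - 1, by omega⟩, by
      simp only
      omega⟩
    refine ⟨_, _, (hX'.addCell hq p c ?_ hle ?_ ?_ ?_).mono ?_, ?_, ?_, ?_⟩
    · exact Or.inr ⟨rfl, by simp only; omega⟩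
    · rw [hPp, Fin.val_succ]
      omega
    · rw [hPp, Fin.val_castSucc]
      omega
    · intro i hi
      rw [hPγ' i hi _ (Fin.castSucc_lt_last c).ne, Fin.val_castSucc]
      have := hγ hi.le
      omega
    · rintro ⟨a, b⟩ h
      refine ⟨h.imp_right fun h => ⟨h.1, by omega⟩, ?_⟩
      rintro ⟨rfl, rfl⟩
      rcases h with h | h
      · exact lt_irrefl _ h
      · have := h.2
        simp only at this
        omega
    · rintro i j (h | h)
      · exact hle i j h
      · exact h.1.le
    · intro i hi j hj
      simp [hi.ne, hPγ' i hi j hj]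
    · intro j
      simp only [hPp, true_and, Fin.ext_iff, Fin.val_castSucc]
      omega

theorem exists_pathModel {q : k} (hq : q ≠ 0) {γ : Fin m → ℕ} (hγ : Monotone γ)
    (hγn : ∀ i, γ i ≤ n) (p : ℕ) (hp : p ≤ m) :
    ∃ P X, IsPathModel (n := n) q P {c | p ≤ c.1} X ∧
      (∀ i j, P i j → (i : ℕ) < p) ∧
      ∀ i : Fin m, (i : ℕ) < p → ∀ j, j ≠ Fin.last n → (P i j ↔ γ i ≤ j) := by
  induction p with
  | zero => exact ⟨_, _, IsPathModel.empty q _, fun _ _ h => h.elim, fun i hi => by omega⟩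
  | succ p ih =>
    obtain ⟨P, X, hX, hP, hPγ⟩ := ih (by omega)
    have hγp := hγn ⟨p, hp⟩
    obtain ⟨P', X', hX', hle, hPγ', hPp⟩ := IsPathModel.exists_addCells hq hγ ⟨p, hp⟩ hX hP hPγ
      (n - γ ⟨p, hp⟩) (by omega)
    refine ⟨P', X', hX'.mono fun c hc => Or.inl hc, fun i j h => Nat.lt_succ_of_le (hle i j h),
      fun i hi j hj => ?_⟩
    rcases lt_or_eq_of_le (Nat.lt_succ_iff.1 hi) with h | h
    · exact hPγ' i h j hj
    · obtain rfl : i = ⟨p, hp⟩ := Fin.ext h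
      rw [hPp]
      omega

/-- There is a quantum matrix, with entries acting on a polynomial ring, whose entries have
prescribed leading terms and which vanishes to the left of a given staircase. -/
theorem exists_quantumMatrix_hasLead {q : k} (hq : q ≠ 0) {γ : Fin m → ℕ} (hγ : Monotone γ)
    (hγn : ∀ i, γ i ≤ n) :
    ∃ X : Fin m → Fin n → Module.End k (CellExp m n →₀ k), IsQuantumMatrix q X ∧
      (∀ i (j : Fin n), (j : ℕ) < γ i → X i j = 0) ∧
      ∀ i (j : Fin n), γ i ≤ j → HasLead (rowOrd m n) (X i j) (tailExp n i j) := by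
  obtain ⟨P, X, hX, -, hP⟩ := exists_pathModel hq hγ hγn m le_rfl
  have hP' : ∀ i (j : Fin n), P i j.castSucc ↔ γ i ≤ j := fun i j =>
    hP i i.isLt _ (Fin.castSucc_lt_last j).ne
  refine ⟨fun i j => X i j.castSucc, ⟨?_, ?_, ?_, ?_⟩, ?_, ?_⟩
  · exact fun i j l h => hX.quantum.row i _ _ (Fin.castSucc_lt_castSucc_iff.2 h)
  · exact fun i i' j h => hX.quantum.col i i' _ h
  · exact fun i i' j l h h' => hX.quantum.antidiag i i' _ _ h (Fin.castSucc_lt_castSucc_iff.2 h')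
  · exact fun i i' j l h h' => hX.quantum.diag i i' _ _ h (Fin.castSucc_lt_castSucc_iff.2 h')
  · exact fun i j h => hX.zero _ _ fun h' => h.not_ge ((hP' i j).1 h')
  · exact fun i j h => hX.lead _ _ ((hP' i j).2 h)

end PathModelExistence

section LeadingTermsOfMinors

variable {k : Type*} [Field k] {m n : ℕ}

theorem Equiv.Perm.eq_one_of_monotone {σ : Equiv.Perm (Fin m)} (h : Monotone σ) : σ = 1 :=
  Equiv.ext fun i => congrFun (((h.strictMono_of_injective σ.injective).range_inj
    strictMono_id).1 (by simp)) i

theorem Equiv.Perm.exists_le_of_le (σ : Equiv.Perm (Fin m)) (s : Fin m) :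
    ∃ i, s ≤ i ∧ σ i ≤ s := by
  by_contra! h
  have := Finset.card_le_card_of_injOn σ (s := Finset.Ici s) (t := Finset.Ioi s)
    (fun i hi => Finset.mem_coe.2 (Finset.mem_Ioi.2 (h i (Finset.mem_Ici.1 hi)))) σ.injective.injOn
  rw [Fin.card_Ici, Fin.card_Ioi] at this
  omega

theorem sum_mul_sub_lt_of_perm (J : Fin m ↪o Fin n) {σ : Equiv.Perm (Fin m)} (hσ : σ ≠ 1) :
    ∑ i : Fin m, (i : ℕ) * (n - J i) < ∑ i : Fin m, (i : ℕ) * (n - J (σ i)) := by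
  have hlt : ∀ i j, n - (J i : ℕ) < n - (J j : ℕ) → j < i := by
    intro i j h
    by_contra! hij
    have : J i ≤ J j := J.monotone hij
    omega
  have hanti : Antivary (fun i : Fin m => (i : ℕ)) fun i => n - (J i : ℕ) :=
    fun i j h => (hlt i j h).le
  refine (hanti.sum_mul_lt_sum_mul_comp_perm_iff (σ := σ)).2 fun h => hσ ?_
  refine Equiv.Perm.eq_one_of_monotone fun i j hij => ?_
  by_contra! hlt'
  have h1 : J (σ j) < J (σ i) := J.strictMono hlt'
  have h2 : (j : ℕ) ≤ i := h (show n - (J (σ i) : ℕ) < n - (J (σ j) : ℕ) by omega)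
  obtain rfl : i = j := le_antisymm hij h2
  exact lt_irrefl _ hlt'

/-- The leading exponent of a maximal minor. -/
def minorExp (J : Fin m ↪o Fin n) : CellExp m n := ∑ i, tailExp n i (J i)

variable {q : k} {γ : Fin m → ℕ} {X : Fin m → Fin n → Module.End k (CellExp m n →₀ k)}

theorem maxMinor_eq_zero_of_not_le (hγ : Monotone γ)
    (hX : ∀ i (j : Fin n), (j : ℕ) < γ i → X i j = 0) (J : Fin m ↪o Fin n) {s : Fin m}
    (hs : (J s : ℕ) < γ s) : maxMinor (-q) X J = 0 := by
  refine Finset.sum_eq_zero fun σ _ => ?_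
  obtain ⟨i, hi, hσi⟩ := σ.exists_le_of_le s
  have h1 : J (σ i) ≤ J s := J.monotone hσi
  have h2 := hγ hi
  rw [List.prod_eq_zero, smul_zero]
  rw [List.mem_ofFn']
  exact ⟨i, hX i _ (by omega)⟩

theorem hasLead_maxMinor (hX0 : ∀ i (j : Fin n), (j : ℕ) < γ i → X i j = 0)
    (hX : ∀ i (j : Fin n), γ i ≤ j → HasLead (rowOrd m n) (X i j) (tailExp n i j))
    (J : Fin m ↪o Fin n) (hJ : ∀ i, γ i ≤ J i) :
    HasLead (rowOrd m n) (maxMinor (-q) X J) (minorExp J) := by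
  have hprod : ∀ σ : Equiv.Perm (Fin m), (∀ i, γ i ≤ J (σ i)) →
      HasLead (rowOrd m n) (List.ofFn fun i => X i (J (σ i))).prod
        (∑ i, tailExp n i (J (σ i))) := by
    intro σ hσ
    have := HasLead.list_prod (ord := rowOrd m n) (fun i => X i (J (σ i)))
      (fun i => tailExp n i (J (σ i))) (List.finRange m) fun i _ => hX i _ (hσ i)
    rwa [← List.ofFn_eq_map, ← List.ofFn_eq_map, List.sum_ofFn] at this
  have hone : permLength (1 : Equiv.Perm (Fin m)) = 0 := by
    rw [permLength, Finset.card_eq_zero, Finset.filter_eq_empty_iff]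
    exact fun x _ h => lt_asymm h.1 h.2
  unfold maxMinor
  rw [← Finset.add_sum_erase _ _ (Finset.mem_univ (1 : Equiv.Perm (Fin m))), hone, pow_zero,
    one_smul]
  refine (hprod 1 hJ).add_higher (RaisesBy.sum fun σ hσ => RaisesBy.smul ?_ _)
  by_cases hall : ∀ i, γ i ≤ J (σ i)
  · refine (hprod σ hall).raisesBy.mono ?_
    have := sum_mul_sub_lt_of_perm J (Finset.ne_of_mem_erase hσ)
    simpa only [map_sum, rowOrd_tailExp, Equiv.Perm.one_apply, Nat.succ_le_iff] using this
  · push Not at hall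
    obtain ⟨i, hi⟩ := hall
    rw [List.prod_eq_zero]
    · exact RaisesBy.zero _
    · rw [List.mem_ofFn']
      exact ⟨i, hX0 i _ hi⟩

theorem List.eq_of_pairwise_of_countP_le {α : Type*} [LinearOrder α] : ∀ {l l' : List α},
    l.Pairwise (· ≤ ·) → l'.Pairwise (· ≤ ·) →
    (∀ c, l.countP (fun x => x ≤ c) = l'.countP (fun x => x ≤ c)) → l = l'
  | [], [], _, _, _ => rfl
  | [], b :: l', _, _, h => by
    have := h b
    simp at this
  | a :: l, [], _, _, h => by
    have := h a
    simp at this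
  | a :: l, b :: l', hl, hl', h => by
    have key : ∀ {a b : α} {l l' : List α}, (b :: l').Pairwise (· ≤ ·) →
        (a :: l).countP (fun x => x ≤ a) = (b :: l').countP (fun x => x ≤ a) → b ≤ a := by
      intro a b l l' hl' h
      have hpos : 0 < (b :: l').countP (fun x => x ≤ a) := by
        rw [← h]
        simp
      obtain ⟨x, hx, hxa⟩ := List.countP_pos_iff.1 hpos
      rw [decide_eq_true_iff] at hxa
      rcases List.mem_cons.1 hx with rfl | hx
      · exact hxa
      · exact ((List.pairwise_cons.1 hl').1 x hx).trans hxa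
    obtain rfl : a = b := le_antisymm (key hl (h b).symm) (key hl' (h a))
    rw [List.eq_of_pairwise_of_countP_le (List.pairwise_cons.1 hl).2
      (List.pairwise_cons.1 hl').2 fun c => ?_]
    have := h c
    simp only [List.countP_cons] at this
    omega

theorem sum_map_minorExp_apply (l : List (Fin m ↪o Fin n)) (i : Fin m) (c : Fin n) :
    (l.map minorExp).sum (i, c) = (l.map fun J => J i).countP (fun x => x ≤ c) := by
  induction l with
  | nil => simp
  | cons J l ih =>
    rw [List.map_cons, List.map_cons, List.sum_cons, Pi.add_apply, ih, List.countP_cons, add_comm]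
    congr 1
    simp [minorExp, tailExp, Finset.sum_apply, ite_and]

theorem sum_map_minorExp_injective (hm : 0 < m) : Function.Injective
    fun l : {l : List (Fin m ↪o Fin n) // l.IsChain (· ≤ ·)} =>
      ((l : List (Fin m ↪o Fin n)).map minorExp).sum := by
  rintro ⟨l, hl⟩ ⟨l', hl'⟩ h
  have hrow : ∀ i : Fin m, (l.map fun J => J i) = l'.map fun J => J i := by
    intro i
    have hp : ∀ {l : List (Fin m ↪o Fin n)}, l.IsChain (· ≤ ·) →
        (l.map fun J => J i).Pairwise (· ≤ ·) := fun hl =>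
      List.pairwise_map.2 ((List.isChain_iff_pairwise.1 hl).imp fun h => h i)
    refine List.eq_of_pairwise_of_countP_le (hp hl) (hp hl') fun c => ?_
    rw [← sum_map_minorExp_apply, ← sum_map_minorExp_apply]
    exact congrFun h (i, c)
  have hlen : l.length = l'.length := by
    simpa using congrArg List.length (hrow ⟨0, hm⟩)
  refine Subtype.ext (List.ext_getElem hlen fun t ht ht' => ?_)
  refine DFunLike.ext _ _ fun i => ?_
  have := List.getElem_of_eq (hrow i) (i := t) (by simpa using ht)
  rwa [List.getElem_map, List.getElem_map] at this

/-- Standard monomials in the maximal minors with entries above the staircase have linearly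
independent images in the model. -/
theorem linearIndependent_standard_above (hm : 0 < m)
    (hX0 : ∀ i (j : Fin n), (j : ℕ) < γ i → X i j = 0)
    (hX : ∀ i (j : Fin n), γ i ≤ j → HasLead (rowOrd m n) (X i j) (tailExp n i j)) :
    LinearIndependent k
      (fun l : {l : {l : List (Fin m ↪o Fin n) // l.IsChain (· ≤ ·)} //
          ∀ J ∈ l.1, ∀ i, γ i ≤ J i} =>
        (l.1.1.map (maxMinor (-q) X)).prod) := by
  refine LinearIndependent.of_comp (LinearMap.applyₗ (Finsupp.single (0 : CellExp m n) (1 : k))) ?_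
  refine linearIndependent_of_lead (ord := rowOrd m n) _ (fun l => (l.1.1.map minorExp).sum)
    (fun l l' h => Subtype.ext (sum_map_minorExp_injective hm h)) fun l => ?_
  have := HasLead.list_prod (ord := rowOrd m n) (maxMinor (-q) X) minorExp l.1.1 fun J hJ =>
    hasLead_maxMinor hX0 hX J (l.2 J hJ)
  simpa using this 0

end LeadingTermsOfMinors

section UniversalProperty

variable {k : Type*} [Field k] {q : k} (hq : q ≠ 0) {m n : ℕ}

theorem isQuantumMatrix_qX : IsQuantumMatrix q fun (i : Fin m) (j : Fin n) =>
    qX k (Units.mk0 q hq) i j where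
  row i j l h := by
    have := RingQuot.mkAlgHom_rel k (qMatrixRel.row (R := k) (u := Units.mk0 q hq) i j l h)
    simpa [qX] using this
  col i i' j h := by
    have := RingQuot.mkAlgHom_rel k (qMatrixRel.col (R := k) (u := Units.mk0 q hq) i i' j h)
    simpa [qX] using this
  antidiag i i' j l h h' := by
    have := RingQuot.mkAlgHom_rel k
      (qMatrixRel.antidiag (R := k) (u := Units.mk0 q hq) i i' j l h h')
    simpa [qX] using this
  diag i i' j l h h' := by
    have := RingQuot.mkAlgHom_rel k
      (qMatrixRel.diag (R := k) (u := Units.mk0 q hq) i i' j l h h')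
    simpa [qX] using this

/-- The universal property of the algebra of quantum matrices. -/
theorem IsQuantumMatrix.exists_algHom {A : Type*} [Ring A] [Algebra k A] {X : Fin m → Fin n → A}
    (hX : IsQuantumMatrix q X) : ∃ ψ : QuantumMat k (Units.mk0 q hq) m n →ₐ[k] A,
      ∀ i j, ψ (qX k (Units.mk0 q hq) i j) = X i j := by
  refine ⟨RingQuot.liftAlgHom k ⟨FreeAlgebra.lift k fun c : Fin m × Fin n => X c.1 c.2, ?_⟩, ?_⟩
  · intro x y h
    induction h with
    | row i j l h => simpa using hX.row i j l h
    | col i i' j h => simpa using hX.col i i' j h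
    | antidiag i i' j l h h' => simpa using hX.antidiag i i' j l h h'
    | diag i i' j l h h' => simpa using hX.diag i i' j l h h'
  · intro i j
    simp [qX]

end UniversalProperty

section Straightening

variable {k : Type*} [Field k] {q : k} (hq : q ≠ 0) {m n : ℕ}

theorem HasLead.ne_zero {V : Type*} [AddCommMonoid V] {ord : V →+ ℕ}
    {T : Module.End k (V →₀ k)} {e : V} (hT : HasLead ord T e) : T ≠ 0 := by
  rintro rfl
  obtain ⟨u, hu0, hu⟩ := hT 0
  have h : e ∈ {w | ord 0 + ord e + 1 ≤ ord w} := hu (by simp [hu0])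
  simp at h

/-- Representations of the quantum grassmannian killing the minors which are not above a given
one, and in which the standard monomials above it are linearly independent. -/
theorem exists_algHom_grassmannian (hm : 0 < m) {γ : Fin m → ℕ} (hγ : Monotone γ)
    (hγn : ∀ i, γ i ≤ n) :
    ∃ ψ : QuantumGrassmannian k (Units.mk0 q hq) m n →ₐ[k] Module.End k (CellExp m n →₀ k),
      (∀ J s, (J s : ℕ) < γ s → ψ (grMinor k (Units.mk0 q hq) J) = 0) ∧
      (∀ I J, (∀ i, γ i ≤ I i) → (∀ i, γ i ≤ J i) →
        ψ (grMinor k (Units.mk0 q hq) I * grMinor k (Units.mk0 q hq) J) ≠ 0) ∧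
      LinearIndependent k (fun l : {l : {l : List (Fin m ↪o Fin n) // l.IsChain (· ≤ ·)} //
          ∀ J ∈ l.1, ∀ i, γ i ≤ J i} =>
        ψ (l.1.1.map (grMinor k (Units.mk0 q hq))).prod) := by
  obtain ⟨X, hX, hX0, hXlead⟩ := exists_quantumMatrix_hasLead hq hγ hγn
  obtain ⟨ψ, hψ⟩ := hX.exists_algHom hq
  have hψJ : ∀ J, ψ.comp (QuantumGrassmannian k (Units.mk0 q hq) m n).val
      (grMinor k (Units.mk0 q hq) J) = maxMinor (-q) X J := by
    intro J
    change ψ (qMaximalMinor k (Units.mk0 q hq) J) = _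
    simp only [qMaximalMinor, map_sum, map_smul, map_list_prod, List.map_ofFn, Function.comp_def,
      hψ]
    rfl
  refine ⟨ψ.comp (QuantumGrassmannian k (Units.mk0 q hq) m n).val, ?_, ?_, ?_⟩
  · intro J s hs
    rw [hψJ, maxMinor_eq_zero_of_not_le hγ hX0 J hs]
  · intro I J hI hJ
    rw [map_mul, hψJ, hψJ]
    exact ((hasLead_maxMinor hX0 hXlead I hI).mul (hasLead_maxMinor hX0 hXlead J hJ)).ne_zero
  · have := linearIndependent_standard_above (q := q) hm hX0 hXlead
    simpa only [map_list_prod, List.map_map, Function.comp_def, hψJ] using this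

theorem linearIndependent_standard (hm : 0 < m) : LinearIndependent k
    (fun l : {l : List (Fin m ↪o Fin n) // l.IsChain (· ≤ ·)} =>
      ((l : List (Fin m ↪o Fin n)).map (grMinor k (Units.mk0 q hq))).prod) := by
  obtain ⟨ψ, -, -, hψ⟩ := exists_algHom_grassmannian (n := n) hq hm (γ := fun _ => 0)
    monotone_const (fun _ => Nat.zero_le _)
  have h1 : LinearIndependent k (fun l : {l : {l : List (Fin m ↪o Fin n) // l.IsChain (· ≤ ·)} //
      ∀ J ∈ l.1, ∀ i, 0 ≤ (J i : ℕ)} =>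
        (l.1.1.map (grMinor k (Units.mk0 q hq))).prod) := LinearIndependent.of_comp ψ.toLinearMap hψ
  exact h1.comp (fun l => ⟨l, fun _ _ _ => Nat.zero_le _⟩) fun l l' h => by
    simpa using h

end Straightening

section StraighteningLaw

variable {k : Type*} [Field k] {m n : ℕ} {G B : Type*} [Ring G] [Algebra k G]
  [Ring B] [Algebra k B] {x : (Fin m ↪o Fin n) → G}

/-- The products of two elements forming a chain. -/
def standardPair (x : (Fin m ↪o Fin n) → G)
    (p : {p : (Fin m ↪o Fin n) × (Fin m ↪o Fin n) // p.1 ≤ p.2}) : G :=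
  x p.1.1 * x p.1.2

/-- A representation killing the `x J` with `J` not above `L`, in which the standard
monomials in the other ones are linearly independent and the products of two of them are
nonzero. -/
structure IsRepresentationAbove (x : (Fin m ↪o Fin n) → G) (L : Fin m ↪o Fin n)
    (ψ : G →ₐ[k] B) : Prop where
  map_eq_zero : ∀ J s, J s < L s → ψ (x J) = 0
  map_mul_ne_zero : ∀ I J, L ≤ I → L ≤ J → ψ (x I * x J) ≠ 0
  linearIndependent : LinearIndependent k
    (fun l : {l : {l : List (Fin m ↪o Fin n) // l.IsChain (· ≤ ·)} // ∀ J ∈ l.1, L ≤ J} =>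
      ψ (l.1.1.map x).prod)

variable (k B) in
/-- There are representations in `B` above each index. -/
def HasRepresentationsAbove (x : (Fin m ↪o Fin n) → G) : Prop :=
  ∀ L, ∃ ψ : G →ₐ[k] B, IsRepresentationAbove x L ψ

theorem IsRepresentationAbove.coeff_eq_zero {ψ : G →ₐ[k] B} {L : Fin m ↪o Fin n}
    (hψ : IsRepresentationAbove x L ψ)
    (c : {p : (Fin m ↪o Fin n) × (Fin m ↪o Fin n) // p.1 ≤ p.2} →₀ k)
    (hc : ψ (Finsupp.linearCombination k (standardPair x) c) = 0)
    (p : {p : (Fin m ↪o Fin n) × (Fin m ↪o Fin n) // p.1 ≤ p.2}) (hp : L ≤ p.1.1) : c p = 0 := by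
  classical
  let chain : {p : {p : (Fin m ↪o Fin n) × (Fin m ↪o Fin n) // p.1 ≤ p.2} // L ≤ p.1.1} →
      {l : {l : List (Fin m ↪o Fin n) // l.IsChain (· ≤ ·)} // ∀ J ∈ l.1, L ≤ J} :=
    fun p => ⟨⟨[p.1.1.1, p.1.1.2], by simpa using p.1.2⟩, by
      intro J hJ
      simp only [List.mem_cons, List.not_mem_nil, or_false] at hJ
      rcases hJ with rfl | rfl
      · exact p.2
      · exact p.2.trans p.1.2⟩
  have hchain : Function.Injective chain := by
    intro p p' h
    have := congrArg (fun l => l.1.1) h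
    simp only [chain, List.cons.injEq, and_true] at this
    exact Subtype.ext (Subtype.ext (Prod.ext this.1 this.2))
  have h2 := hψ.linearIndependent.comp chain hchain
  rw [linearIndependent_iff'] at h2
  by_contra hcp
  refine hcp (h2 (c.support.subtype fun p => L ≤ p.1.1) (fun p => c p.1) ?_ ⟨p, hp⟩
    (by simpa using hcp))
  rw [Finsupp.linearCombination_apply, Finsupp.sum, map_sum] at hc
  rw [← hc]
  have hval : ∀ p, (fun l : {l : {l : List (Fin m ↪o Fin n) // l.IsChain (· ≤ ·)} //
      ∀ J ∈ l.1, L ≤ J} => ψ (l.1.1.map x).prod) (chain p) = ψ (standardPair x p.1) := fun p => by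
    simp [chain, standardPair]
  simp only [Function.comp_apply, hval]
  rw [Finset.sum_subtype_eq_sum_filter (f := fun p => c p • ψ (standardPair x p)),
    Finset.sum_filter_of_ne]
  · simp only [map_smul]
  · intro p _ hne s
    by_contra! hs
    exact hne (by rw [standardPair, map_mul, hψ.map_eq_zero _ s hs, zero_mul, smul_zero])

variable (m n) in
theorem OrderEmbedding.ofFn_multiset_injective : Function.Injective
    fun J : Fin m ↪o Fin n => ((List.ofFn J : List (Fin n)) : Multiset (Fin n)) := by
  intro I J h
  have hl : List.ofFn I = List.ofFn J := List.Perm.eq_of_pairwise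
    (fun a b _ _ h h' => le_antisymm h h') ((OrderEmbedding.pairwise_ofFn I).imp fun h => h.le)
    ((OrderEmbedding.pairwise_ofFn J).imp fun h => h.le) (Multiset.coe_eq_coe.1 h)
  exact DFunLike.coe_injective (List.ofFn_injective hl)

/-- The standard products of two elements with the same content as `a` and `b`. -/
def sameContentTerms (x : (Fin m ↪o Fin n) → G) (a b : Fin m ↪o Fin n) : Set G :=
  {y | ∃ L M : Fin m ↪o Fin n, L ≤ M ∧
    ((List.ofFn L : List (Fin n)) : Multiset (Fin n)) + (List.ofFn M : List (Fin n)) =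
      (List.ofFn a : List (Fin n)) + (List.ofFn b : List (Fin n)) ∧ y = x L * x M}

/-- The straightening relations, with the bound on the smaller factors. -/
theorem exists_straightening (hrep : HasRepresentationsAbove k B x)
    {a b : Fin m ↪o Fin n} (hspan : x a * x b ∈ Submodule.span k (sameContentTerms x a b)) :
    ∃ c : {p : (Fin m ↪o Fin n) × (Fin m ↪o Fin n) // p.1 ≤ p.2} →₀ k,
      x a * x b = Finsupp.linearCombination k (standardPair x) c ∧
      ∀ p, c p ≠ 0 → p.1.1 ≤ a ∧ p.1.1 ≤ b ∧
        ((List.ofFn p.1.1 : List (Fin n)) : Multiset (Fin n)) + (List.ofFn p.1.2 : List (Fin n)) =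
          (List.ofFn a : List (Fin n)) + (List.ofFn b : List (Fin n)) := by
  obtain ⟨c, hc, hsum⟩ : ∃ c : {p : (Fin m ↪o Fin n) × (Fin m ↪o Fin n) // p.1 ≤ p.2} →₀ k,
      c ∈ Finsupp.supported k k {p |
        ((List.ofFn p.1.1 : List (Fin n)) : Multiset (Fin n)) + (List.ofFn p.1.2 : List (Fin n)) =
          (List.ofFn a : List (Fin n)) + (List.ofFn b : List (Fin n))} ∧
      Finsupp.linearCombination k (standardPair x) c = x a * x b := by
    rw [← Finsupp.mem_span_image_iff_linearCombination]
    refine Submodule.span_mono ?_ hspan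
    rintro _ ⟨L, M, hLM, hcontent, rfl⟩
    exact ⟨⟨(L, M), hLM⟩, hcontent, rfl⟩
  refine ⟨c, hsum.symm, fun p hp => ?_⟩
  obtain ⟨ψ, hψ⟩ := hrep p.1.1
  have hz : ψ (Finsupp.linearCombination k (standardPair x) c) ≠ 0 := fun hz =>
    hp (hψ.coeff_eq_zero c hz p le_rfl)
  rw [hsum, map_mul] at hz
  refine ⟨fun s => ?_, fun s => ?_, hc (Finsupp.mem_support_iff.2 hp)⟩
  · by_contra! hs
    exact left_ne_zero_of_mul hz (hψ.map_eq_zero a s hs)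
  · by_contra! hs
    exact right_ne_zero_of_mul hz (hψ.map_eq_zero b s hs)

/-- The terms which may occur in a straightening law. -/
def lowerTerms (x : (Fin m ↪o Fin n) → G) (a b : Fin m ↪o Fin n) : Set G :=
  {y | ∃ lam : Fin m ↪o Fin n, lam < a ∧ lam < b ∧ (y = x lam ∨
    ∃ mu : Fin m ↪o Fin n, lam ≤ mu ∧ y = x lam * x mu)}

theorem lowerTerms_comm (a b : Fin m ↪o Fin n) : lowerTerms x a b = lowerTerms x b a := by
  ext y
  simp only [lowerTerms, Set.mem_ofPred_eq, and_left_comm]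

theorem mul_mem_span_lowerTerms (hrep : HasRepresentationsAbove k B x)
    (hspan : ∀ a b, x a * x b ∈ Submodule.span k (sameContentTerms x a b))
    {a b : Fin m ↪o Fin n} (hab : ¬ a ≤ b) (hba : ¬ b ≤ a) :
    x a * x b ∈ Submodule.span k (lowerTerms x a b) := by
  obtain ⟨c, hsum, hc⟩ := exists_straightening hrep (hspan a b)
  rw [hsum, Finsupp.linearCombination_apply]
  refine Submodule.sum_mem _ fun p hp => Submodule.smul_mem _ _ (Submodule.subset_span ?_)
  obtain ⟨ha, hb, -⟩ := hc p (Finsupp.mem_support_iff.1 hp)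
  refine ⟨p.1.1, lt_of_le_of_ne ha ?_, lt_of_le_of_ne hb ?_, Or.inr ⟨p.1.2, p.2, rfl⟩⟩
  · rintro h
    exact hab (h ▸ hb)
  · rintro h
    exact hba (h ▸ ha)

theorem exists_mul_sub_mem_span_of_le (hrep : HasRepresentationsAbove k B x)
    (hspan : ∀ a b, x a * x b ∈ Submodule.span k (sameContentTerms x a b))
    {a b : Fin m ↪o Fin n} (hab : a ≤ b) :
    ∃ c : k, c ≠ 0 ∧ x b * x a - c • (x a * x b) ∈ Submodule.span k (lowerTerms x a b) := by
  obtain ⟨c, hsum, hc⟩ := exists_straightening hrep (hspan b a)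
  have hlt : ∀ p, c p ≠ 0 → p ≠ ⟨(a, b), hab⟩ → p.1.1 < a := by
    intro p hp hne
    obtain ⟨-, ha, hcontent⟩ := hc p hp
    refine lt_of_le_of_ne ha fun h => hne ?_
    rw [h, add_comm (List.ofFn b : Multiset (Fin n)), add_right_inj] at hcontent
    exact Subtype.ext (Prod.ext h (OrderEmbedding.ofFn_multiset_injective m n hcontent))
  refine ⟨c ⟨(a, b), hab⟩, fun h0 => ?_, ?_⟩
  · obtain ⟨ψ, hψ⟩ := hrep a
    refine hψ.map_mul_ne_zero b a hab le_rfl ?_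
    rw [hsum, Finsupp.linearCombination_apply, Finsupp.sum, map_sum]
    refine Finset.sum_eq_zero fun p hp => ?_
    rw [Finsupp.mem_support_iff] at hp
    have hpa := hlt p hp fun h => hp (h ▸ h0)
    obtain ⟨s, hs⟩ : ∃ s, p.1.1 s < a s := by
      by_contra! h
      exact hpa.not_ge h
    rw [map_smul, standardPair, map_mul, hψ.map_eq_zero _ s hs, zero_mul, smul_zero]
  · have hsplit := Finsupp.add_sum_erase' c ⟨(a, b), hab⟩ (fun p r => r • standardPair x p)
      fun p => zero_smul _ _
    rw [hsum, Finsupp.linearCombination_apply, ← hsplit, standardPair, add_sub_cancel_left]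
    refine Submodule.sum_mem _ fun p hp => Submodule.smul_mem _ _ (Submodule.subset_span ?_)
    rw [Finsupp.support_erase, Finset.mem_erase, Finsupp.mem_support_iff] at hp
    have hpa := hlt p hp.2 hp.1
    exact ⟨p.1.1, hpa, hpa.trans_le hab, Or.inr ⟨p.1.2, p.2, rfl⟩⟩

theorem exists_mul_sub_mem_span (hrep : HasRepresentationsAbove k B x)
    (hspan : ∀ a b, x a * x b ∈ Submodule.span k (sameContentTerms x a b))
    (a b : Fin m ↪o Fin n) :
    ∃ c : k, c ≠ 0 ∧ x a * x b - c • (x b * x a) ∈ Submodule.span k (lowerTerms x a b) := by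
  by_cases hab : a ≤ b
  · obtain ⟨c, hc, h⟩ := exists_mul_sub_mem_span_of_le hrep hspan hab
    refine ⟨c⁻¹, inv_ne_zero hc, ?_⟩
    have := Submodule.smul_mem _ (-c⁻¹) h
    rwa [smul_sub, smul_smul, neg_mul, inv_mul_cancel₀ hc, neg_one_smul, sub_neg_eq_add,
      add_comm, neg_smul, ← sub_eq_add_neg] at this
  by_cases hba : b ≤ a
  · rw [lowerTerms_comm]
    exact exists_mul_sub_mem_span_of_le hrep hspan hba
  refine ⟨1, one_ne_zero, ?_⟩
  rw [one_smul]
  refine Submodule.sub_mem _ (mul_mem_span_lowerTerms hrep hspan hab hba) ?_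
  rw [lowerTerms_comm]
  exact mul_mem_span_lowerTerms hrep hspan hba hab

end StraighteningLaw

section Grassmannian

variable {k : Type*} [Field k] {q : k} (hq : q ≠ 0) {m n : ℕ}

theorem hasRepresentationsAbove_grMinor (hm : 0 < m) :
    HasRepresentationsAbove k (Module.End k (CellExp m n →₀ k))
      (grMinor k (Units.mk0 q hq) (m := m) (n := n)) := by
  intro L
  obtain ⟨ψ, h0, h1, h2⟩ := exists_algHom_grassmannian (n := n) hq hm
    (γ := fun i => (L i : ℕ)) (fun i j h => L.monotone h) (fun i => (L i).isLt.le)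
  exact ⟨ψ, h0, h1, h2⟩

theorem grMinor_mul_mem_span (a b : Fin m ↪o Fin n) :
    grMinor k (Units.mk0 q hq) a * grMinor k (Units.mk0 q hq) b ∈
      Submodule.span k (sameContentTerms (grMinor k (Units.mk0 q hq)) a b) := by
  have hspan := (isQuantumMatrix_qX (m := m) (n := n) hq).maxMinor_mul_mem_span hq a b
  have hsub : Submodule.span k (sameContentTerms (qMaximalMinor k (Units.mk0 q hq)) a b) ≤
      (Submodule.span k (sameContentTerms (grMinor k (Units.mk0 q hq)) a b)).map
        (QuantumGrassmannian k (Units.mk0 q hq) m n).val.toLinearMap := by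
    rw [Submodule.span_le]
    rintro _ ⟨L, M, hLM, hcontent, rfl⟩
    exact ⟨_, Submodule.subset_span ⟨L, M, hLM, hcontent, rfl⟩, rfl⟩
  obtain ⟨y, hy, hya⟩ := hsub hspan
  have hy' : y = grMinor k (Units.mk0 q hq) a * grMinor k (Units.mk0 q hq) b := Subtype.ext hya
  exact hy' ▸ hy

end Grassmannian

section Grading

open Polynomial

variable {k : Type*} [Field k] {A : Type*} [Ring A] [Algebra k A]

theorem IsQuantumMatrix.monomial_one {q : k} {m n : ℕ} {X : Fin m → Fin n → A}
    (hX : IsQuantumMatrix q X) : IsQuantumMatrix q fun i j => monomial 1 (X i j) where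
  row i j l h := by
    simp only [monomial_mul_monomial, smul_monomial, hX.row i j l h]
  col i i' j h := by
    simp only [monomial_mul_monomial, smul_monomial, hX.col i i' j h]
  antidiag i i' j l h h' := by
    simp only [monomial_mul_monomial, hX.antidiag i i' j l h h']
  diag i i' j l h h' := by
    simp only [monomial_mul_monomial, smul_monomial, hX.diag i i' j l h h', map_add]

theorem Polynomial.prod_map_monomial_one (l : List A) :
    (l.map (monomial 1)).prod = monomial l.length l.prod := by
  induction l with
  | nil => simp
  | cons a l ih => simp [ih, monomial_mul_monomial, add_comm]

/-- The homogeneous elements of degree `d` of `B ⊆ A`, for a coaction `η` of the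
multiplicative monoid. -/
def homogeneousPart {B : Type*} [Ring B] [Algebra k B] (ι : B →ₐ[k] A) (η : B →ₐ[k] A[X])
    (d : ℕ) : Submodule k B where
  carrier := {a | η a = monomial d (ι a)}
  add_mem' {a b} ha hb := by
    simp only [Set.mem_ofPred_eq] at ha hb ⊢
    rw [map_add, ha, hb, map_add, map_add]
  zero_mem' := by simp
  smul_mem' c a ha := by
    simp only [Set.mem_ofPred_eq] at ha ⊢
    rw [map_smul, ha, map_smul, smul_monomial]

variable {B : Type*} [Ring B] [Algebra k B] {ι : B →ₐ[k] A} {η : B →ₐ[k] A[X]}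

theorem mem_homogeneousPart {d : ℕ} {a : B} :
    a ∈ homogeneousPart ι η d ↔ η a = monomial d (ι a) := Iff.rfl

variable (ι η) in
theorem gradedMonoid_homogeneousPart : SetLike.GradedMonoid (homogeneousPart ι η) where
  one_mem := by simp [mem_homogeneousPart]
  mul_mem i j a b ha hb := by
    rw [mem_homogeneousPart] at *
    rw [map_mul, ha, hb, monomial_mul_monomial, map_mul ι]

theorem iSupIndep_homogeneousPart (hι : Function.Injective ι) :
    iSupIndep (homogeneousPart ι η) := by
  rw [iSupIndep_def]
  intro i
  have hle : ⨆ j ≠ i, homogeneousPart ι η j ≤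
      LinearMap.ker (((lcoeff A i).restrictScalars k).comp η.toLinearMap) := by
    refine iSup₂_le fun j hj a ha => ?_
    rw [mem_homogeneousPart] at ha
    simp [ha, coeff_monomial, hj]
  rw [Submodule.disjoint_def]
  intro a ha ha'
  have h := hle ha'
  rw [mem_homogeneousPart] at ha
  rw [← map_eq_zero_iff ι hι]
  simpa [ha] using h

theorem nonempty_gradedAlgebra_homogeneousPart (hι : Function.Injective ι) {s : Set B}
    (hs : Algebra.adjoin k s = ⊤) (hη : ∀ a ∈ s, ∃ d, a ∈ homogeneousPart ι η d) :
    Nonempty (GradedAlgebra (homogeneousPart ι η)) := by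
  have := gradedMonoid_homogeneousPart ι η
  have htop : ⨆ d, homogeneousPart ι η d = ⊤ := by
    rw [Submodule.iSup_eq_toSubmodule_range, Algebra.toSubmodule_eq_top, eq_top_iff, ← hs,
      Algebra.adjoin_le_iff]
    intro a ha
    obtain ⟨d, hd⟩ := hη a ha
    exact ⟨DirectSum.of (fun d => homogeneousPart ι η d) d ⟨a, hd⟩, by simp⟩
  have hinternal := DirectSum.isInternal_submodule_of_iSupIndep_of_iSup_eq_top
    (iSupIndep_homogeneousPart (η := η) hι) htop
  exact ⟨{ gradedMonoid_homogeneousPart ι η, hinternal.chooseDecomposition with }⟩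

end Grading

section Assembly

variable {k : Type*} [Field k] {q : k} (hq : q ≠ 0) {m n : ℕ}

theorem adjoin_range_grMinor :
    Algebra.adjoin k (Set.range (grMinor k (Units.mk0 q hq) (m := m) (n := n))) = ⊤ := by
  refine (congrArg _ (Set.ext fun a => ?_)).trans (Algebra.adjoin_adjoin_coe_preimage (R := k)
    (s := Set.range fun J : Fin m ↪o Fin n => qMaximalMinor k (Units.mk0 q hq) J))
  exact ⟨fun ⟨J, hJ⟩ => ⟨J, congrArg Subtype.val hJ⟩, fun ⟨J, hJ⟩ => ⟨J, Subtype.ext hJ⟩⟩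

theorem exists_coaction :
    ∃ η : QuantumGrassmannian k (Units.mk0 q hq) m n →ₐ[k]
        Polynomial (QuantumMat k (Units.mk0 q hq) m n), ∀ J,
      η (grMinor k (Units.mk0 q hq) J) =
        Polynomial.monomial m (qMaximalMinor k (Units.mk0 q hq) J) := by
  obtain ⟨η, hη⟩ := (isQuantumMatrix_qX (m := m) (n := n) hq).monomial_one.exists_algHom hq
  refine ⟨η.comp (QuantumGrassmannian k (Units.mk0 q hq) m n).val, fun J => ?_⟩
  change η (qMaximalMinor k (Units.mk0 q hq) J) = _
  simp only [qMaximalMinor, map_sum, map_smul, map_list_prod, List.map_ofFn, Function.comp_def,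
    hη, ← Polynomial.smul_monomial]
  refine Finset.sum_congr rfl fun σ _ => ?_
  have := Polynomial.prod_map_monomial_one
    (List.ofFn fun i : Fin m => qX k (Units.mk0 q hq) i (J (σ i)))
  rw [List.map_ofFn, List.length_ofFn] at this
  congr 1

end Assembly

/-- Let `k` be a field, `q ∈ k` nonzero and `m ≤ n` positive integers.
Then the quantum grassmannian `O_q(G_{m,n}(k))` — graded by total degree in the `X i j`, so
that each maximal minor `[J]` is homogeneous of degree `m` — is a quantum graded algebra with
a straightening law on the poset `(Π_{m,n}, ≤st)` of maximal quantum minors. -/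
theorem quantumGrassmannian_isQASL (k : Type*) [Field k] (q : k) (hq : q ≠ 0)
    (m n : ℕ) (hm : 0 < m) (hmn : m ≤ n) :
    ∃ (𝒜 : ℕ → Submodule k (QuantumGrassmannian k (Units.mk0 q hq) m n))
      (Q : QuantumGradedASL k (QuantumGrassmannian k (Units.mk0 q hq) m n) 𝒜
        (Fin m ↪o Fin n)),
      (∀ J : Fin m ↪o Fin n, Q.elem J = grMinor k (Units.mk0 q hq) J) ∧
      (∀ J : Fin m ↪o Fin n, grMinor k (Units.mk0 q hq) J ∈ 𝒜 m) := by
  obtain ⟨η, hη⟩ := exists_coaction (m := m) (n := n) hq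
  obtain ⟨hgr⟩ := nonempty_gradedAlgebra_homogeneousPart
    (B := QuantumGrassmannian k (Units.mk0 q hq) m n)
    (ι := (QuantumGrassmannian k (Units.mk0 q hq) m n).val) (η := η) Subtype.val_injective
    (adjoin_range_grMinor hq) (by
      rintro _ ⟨J, rfl⟩
      exact ⟨m, hη J⟩)
  have hrep := hasRepresentationsAbove_grMinor (n := n) hq hm
  exact ⟨_, {
    elem := grMinor k (Units.mk0 q hq)
    graded := hgr
    homog := fun J => ⟨m, hm, hη J⟩
    gen := adjoin_range_grMinor hq
    indep := linearIndependent_standard hq hm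
    straighten := fun a b hab hba => mul_mem_span_lowerTerms hrep (grMinor_mul_mem_span hq) hab hba
    comm := exists_mul_sub_mem_span hrep (grMinor_mul_mem_span hq) },
    fun _ => rfl, hη⟩
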